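/- Let κ be a perfect kernel on X, f an external field, and A ⊆ X a quasicompact set with w_f(A) < ∞. Then the inner Gauss variational problem for (A, f) has a unique solution λ_{A,f} ∈ Ĕ⁺_f(A) with I_f(λ_{A,f}) = w_f(A). -/

import Mathlib

open MeasureTheory Topology Filter Set ENNReal

noncomputable section

namespace GaussVar

variable {X : Type*} [TopologicalSpace X] [MeasurableSpace X]

/-- A (positive) Radon measure: a regular Borel measure. -/
def IsRadon (μ : Measure X) : Prop := μ.Regular

/-- The mutual energy `I(μ,ν) = ∬ κ(x,y) d(μ⊗ν)(x,y)`. -/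
def mutualEnergy (κ : X → X → ℝ≥0∞) (μ ν : Measure X) : ℝ≥0∞ :=
  ∫⁻ p : X × X, κ p.1 p.2 ∂(μ.prod ν)

/-- The energy `I(μ) := I(μ,μ)`. -/
def energy (κ : X → X → ℝ≥0∞) (μ : Measure X) : ℝ≥0∞ := mutualEnergy κ μ μ

/-- Membership in the cone `E⁺` of Radon measures with finite energy. -/
def memEplus (κ : X → X → ℝ≥0∞) (μ : Measure X) : Prop :=
  IsRadon μ ∧ energy κ μ < ⊤

/-- A kernel: symmetric and lower semicontinuous with values in `[0,∞]`. -/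
def IsKernel (κ : X → X → ℝ≥0∞) : Prop :=
  (∀ x y, κ x y = κ y x) ∧ LowerSemicontinuous (fun p : X × X => κ p.1 p.2)

/-- The strong (energy) metric `d(μ,ν) := (I(μ)+I(ν)−2I(μ,ν))^{1/2}` on `E⁺`. -/
def strongDist (κ : X → X → ℝ≥0∞) (μ ν : Measure X) : ℝ :=
  Real.sqrt ((energy κ μ).toReal + (energy κ ν).toReal - 2 * (mutualEnergy κ μ ν).toReal)

/-- The energy principle (strict positive definiteness). -/
def EnergyPrinciple (κ : X → X → ℝ≥0∞) : Prop :=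
  ∀ μ ν : Measure X, memEplus κ μ → memEplus κ ν →
    2 * mutualEnergy κ μ ν ≤ energy κ μ + energy κ ν ∧
      (2 * mutualEnergy κ μ ν = energy κ μ + energy κ ν → μ = ν)

/-- Convergence of a sequence in the strong metric. -/
def StrongTendstoSeq (κ : X → X → ℝ≥0∞) (μ : ℕ → Measure X) (μ₀ : Measure X) : Prop :=
  Tendsto (fun n => strongDist κ (μ n) μ₀) atTop (𝓝 0)

/-- Vague convergence of a sequence of measures. -/
def VagueTendstoSeq (μ : ℕ → Measure X) (μ₀ : Measure X) : Prop :=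
  ∀ φ : X → ℝ, Continuous φ → HasCompactSupport φ →
    Tendsto (fun n => ∫ x, φ x ∂(μ n)) atTop (𝓝 (∫ x, φ x ∂μ₀))

/-- Cauchy sequence in the strong metric. -/
def StrongCauchySeq (κ : X → X → ℝ≥0∞) (μ : ℕ → Measure X) : Prop :=
  ∀ ε : ℝ, 0 < ε → ∃ N : ℕ, ∀ m ≥ N, ∀ n ≥ N, strongDist κ (μ m) (μ n) < ε

/-- A perfect kernel: satisfies the energy principle, `(E⁺,d)` is complete, and
strong convergence implies vague convergence. -/
def IsPerfect (κ : X → X → ℝ≥0∞) : Prop :=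
  EnergyPrinciple κ ∧
    (∀ μ : ℕ → Measure X, (∀ n, memEplus κ (μ n)) → StrongCauchySeq κ μ →
        ∃ μ₀ : Measure X, memEplus κ μ₀ ∧ StrongTendstoSeq κ μ μ₀) ∧
    (∀ (μ : ℕ → Measure X) (μ₀ : Measure X), (∀ n, memEplus κ (μ n)) → memEplus κ μ₀ →
        StrongTendstoSeq κ μ μ₀ → VagueTendstoSeq μ μ₀)

/-- `μ` is concentrated on `A`: the complement of `A` is locally `μ`-negligible. -/
def Concentrated (μ : Measure X) (A : Set X) : Prop :=
  ∀ K : Set X, IsCompact K → μ (Aᶜ ∩ K) = 0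

/-- Membership in `Ĕ⁺(A)`: finite-energy Radon measures concentrated on `A`
of unit total mass. -/
def memBreve (κ : X → X → ℝ≥0∞) (A : Set X) (μ : Measure X) : Prop :=
  memEplus κ μ ∧ Concentrated μ A ∧ μ Set.univ = 1

/-- `w(A) := inf { I(μ) : μ ∈ Ĕ⁺(A) }` (with `inf ∅ = ⊤`). -/
def wcap (κ : X → X → ℝ≥0∞) (A : Set X) : ℝ≥0∞ :=
  ⨅ (μ : Measure X) (_ : memBreve κ A μ), energy κ μ

/-- The inner capacity `cap_*(A) := 1 / w(A)`. -/
def innerCap (κ : X → X → ℝ≥0∞) (A : Set X) : ℝ≥0∞ := (wcap κ A)⁻¹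

/-- The outer capacity `cap^*(E) := inf { cap_*(D) : D open, E ⊆ D }`. -/
def outerCap (κ : X → X → ℝ≥0∞) (E : Set X) : ℝ≥0∞ :=
  ⨅ (D : Set X) (_ : IsOpen D ∧ E ⊆ D), innerCap κ D

/-- `P` holds nearly everywhere (n.e.) on `A`: the exceptional subset of `A`
has inner capacity zero. -/
def NearlyEverywhere (κ : X → X → ℝ≥0∞) (A : Set X) (P : X → Prop) : Prop :=
  innerCap κ {x ∈ A | ¬ P x} = 0

/-- The potential `U^μ(x) := ∫ κ(x,y) dμ(y)`. -/
def potential (κ : X → X → ℝ≥0∞) (μ : Measure X) (x : X) : ℝ≥0∞ :=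
  ∫⁻ y, κ x y ∂μ

/-- An external field: `f = ψ + U^{ϑ⁺} − U^{ϑ⁻}` where `ψ` is lower semicontinuous,
`(−∞,∞]`-valued, positive if `X` is noncompact, and `ϑ⁺, ϑ⁻ ∈ E⁺`. -/
def IsExternalField (κ : X → X → ℝ≥0∞) (f : X → EReal) : Prop :=
  ∃ (ψ : X → EReal) (ϑp ϑm : Measure X),
    LowerSemicontinuous ψ ∧ (∀ x, ψ x ≠ ⊥) ∧ (¬ CompactSpace X → ∀ x, 0 ≤ ψ x) ∧
    memEplus κ ϑp ∧ memEplus κ ϑm ∧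
    ∀ x, f x = ψ x + (potential κ ϑp x : EReal) - (potential κ ϑm x : EReal)

/-- `f` is `μ`-integrable (as an extended-real-valued function). -/
def FieldIntegrable (f : X → EReal) (μ : Measure X) : Prop :=
  Integrable (fun x => (f x).toReal) μ ∧ (∀ᵐ x ∂μ, f x ≠ ⊤ ∧ f x ≠ ⊥)

/-- `∫ f dμ` for an a.e.-finite integrable field. -/
def fieldIntegral (f : X → EReal) (μ : Measure X) : ℝ := ∫ x, (f x).toReal ∂μ

/-- The Gauss functional `I_f(μ) := I(μ) + 2 ∫ f dμ`. -/
def gaussI (κ : X → X → ℝ≥0∞) (f : X → EReal) (μ : Measure X) : ℝ :=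
  (energy κ μ).toReal + 2 * fieldIntegral f μ

/-- Membership in `Ĕ⁺_f(A)`. -/
def Admissible (κ : X → X → ℝ≥0∞) (A : Set X) (f : X → EReal) (μ : Measure X) : Prop :=
  memBreve κ A μ ∧ FieldIntegrable f μ

/-- `w_f(A) := inf { I_f(μ) : μ ∈ Ĕ⁺_f(A) }` (with `inf ∅ = ⊤`). -/
def wf (κ : X → X → ℝ≥0∞) (A : Set X) (f : X → EReal) : EReal :=
  ⨅ (μ : Measure X) (_ : Admissible κ A f μ), ((gaussI κ f μ : ℝ) : EReal)

/-- `l` is a solution of the inner Gauss variational problem for `(A,f)`. -/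
def IsSolution (κ : X → X → ℝ≥0∞) (A : Set X) (f : X → EReal) (l : Measure X) : Prop :=
  Admissible κ A f l ∧ ((gaussI κ f l : ℝ) : EReal) = wf κ A f

/-- The `f`-weighted potential `U_f^μ := U^μ + f`. -/
def wPotential (κ : X → X → ℝ≥0∞) (f : X → EReal) (μ : Measure X) (x : X) : EReal :=
  (potential κ μ x : EReal) + f x

/-- `∫ U_f^μ dμ`, the weighted equilibrium constant of a solution. -/
def wConst (κ : X → X → ℝ≥0∞) (f : X → EReal) (μ : Measure X) : ℝ :=
  ∫ x, (wPotential κ f μ x).toReal ∂μ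

/-- The cone `E⁺(A)` is closed in the strong metric. -/
def StrongClosedEplusOn (κ : X → X → ℝ≥0∞) (A : Set X) : Prop :=
  ∀ (μ : ℕ → Measure X) (μ₀ : Measure X),
    (∀ n, memEplus κ (μ n) ∧ Concentrated (μ n) A) →
    memEplus κ μ₀ → StrongTendstoSeq κ μ μ₀ → Concentrated μ₀ A

/-- Frostman's (first) maximum principle. -/
def FrostmanMax (κ : X → X → ℝ≥0∞) : Prop :=
  ∀ μ : Measure X, memEplus κ μ →
    (∀ x : X, (∀ U : Set X, IsOpen U → x ∈ U → 0 < μ U) → potential κ μ x ≤ 1) →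
    ∀ x : X, potential κ μ x ≤ 1

/-- The domination (second maximum) principle. -/
def DominationPrinciple (κ : X → X → ℝ≥0∞) : Prop :=
  ∀ μ ν : Measure X, memEplus κ μ → memEplus κ ν →
    (∀ᵐ x ∂μ, potential κ μ x ≤ potential κ ν x) →
    ∀ x : X, potential κ μ x ≤ potential κ ν x

/-- `β` is the inner balayage of `ζ` onto `A`: `β ∈ E⁺(A)` and `U^β = U^ζ` n.e. on `A`. -/
def IsInnerBalayage (κ : X → X → ℝ≥0∞) (A : Set X) (ζ β : Measure X) : Prop :=
  memEplus κ β ∧ Concentrated β A ∧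
    NearlyEverywhere κ A (fun x => potential κ β x = potential κ ζ x)

/-- `γ` is the inner capacitary measure of `A`: `γ ∈ E⁺(A)` and `U^γ = 1` n.e. on `A`. -/
def IsCapacitaryMeasure (κ : X → X → ℝ≥0∞) (A : Set X) (γ : Measure X) : Prop :=
  memEplus κ γ ∧ Concentrated γ A ∧
    NearlyEverywhere κ A (fun x => potential κ γ x = 1)

/-- `A` is quasiclosed: approximable in outer capacity by closed sets. -/
def Quasiclosed (κ : X → X → ℝ≥0∞) (A : Set X) : Prop :=
  ∀ ε : ℝ≥0∞, 0 < ε → ∃ F : Set X, IsClosed F ∧ outerCap κ (symmDiff A F) < ε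

/-- `A` is quasicompact: approximable in outer capacity by compact sets. -/
def Quasicompact (κ : X → X → ℝ≥0∞) (A : Set X) : Prop :=
  ∀ ε : ℝ≥0∞, 0 < ε → ∃ K : Set X, IsCompact K ∧ outerCap κ (symmDiff A K) < ε

section Semicontinuous

/-- Monotone convergence for directed families of lower semicontinuous functions against a finite
regular measure. -/
theorem lintegral_iSup_of_lowerSemicontinuous [T2Space X] [BorelSpace X] {ι : Type*} [Nonempty ι]
    (μ : Measure X) [IsFiniteMeasure μ] [μ.Regular] (g : ι → X → ℝ≥0∞)
    (hg : ∀ i, LowerSemicontinuous (g i)) (hd : Directed (· ≤ ·) g) :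
    ∫⁻ x, ⨆ i, g i x ∂μ = ⨆ i, ∫⁻ x, g i x ∂μ := by
  refine le_antisymm ?_ (iSup_le fun i => lintegral_mono fun x => le_iSup (fun i => g i x) i)
  rw [lintegral_eq_nnreal]
  refine iSup₂_le fun s hs => ?_
  rw [← SimpleFunc.lintegral_eq_lintegral]
  obtain ⟨C, hC⟩ := s.finite_range.bddAbove
  have hsC : ∀ x, (s x : ℝ≥0∞) ≤ C := fun x => ENNReal.coe_le_coe.2 (hC (mem_range_self x))
  have hfin : ∫⁻ x, (s x : ℝ≥0∞) ∂μ ≠ ∞ := by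
    refine ne_top_of_le_ne_top ?_ (lintegral_mono hsC)
    rw [lintegral_const]
    exact ENNReal.mul_ne_top ENNReal.coe_ne_top (measure_ne_top _ _)
  refine ENNReal.le_of_forall_pos_le_add fun ε hε _ => ?_
  -- an upper semicontinuous minorant
  obtain ⟨u, hus, hu, hui⟩ := SimpleFunc.exists_upperSemicontinuous_le_lintegral_le (μ := μ) s hfin
    (ε := ε / 3) (by simpa using hε.ne')
  -- a large compact set
  have hε3 : (ε : ℝ≥0∞) / 3 ≠ 0 := by simpa using hε.ne'
  obtain ⟨δ, hδ, hδ'⟩ := ENNReal.exists_nnreal_pos_mul_lt (a := (C : ℝ≥0∞)) ENNReal.coe_ne_top hε3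
  replace hδ : (δ : ℝ≥0∞) ≠ 0 := by exact_mod_cast hδ.ne'
  obtain ⟨K, -, hK, hKδ⟩ := MeasurableSet.univ.exists_isCompact_sdiff_lt (μ := μ)
    (measure_ne_top _ _) hδ
  obtain ⟨η, hη, hη'⟩ := ENNReal.exists_nnreal_pos_mul_lt (measure_ne_top μ univ) hε3
  have hopen : ∀ i, IsOpen {x | (u x : ℝ≥0∞) < g i x + η} := by
    intro i
    rw [isOpen_iff_mem_nhds]
    intro x hx
    have hx : (u x : ℝ≥0∞) < g i x + η := hx
    obtain ⟨r, hr1, hr2⟩ := ENNReal.lt_iff_exists_nnreal_btwn.1 hx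
    have hlsc : LowerSemicontinuous fun y => g i y + (η : ℝ≥0∞) :=
      (hg i).add lowerSemicontinuous_const
    filter_upwards [hu x r (by exact_mod_cast hr1), hlsc x r hr2] with y hy1 hy2
    exact lt_trans (by exact_mod_cast hy1) hy2
  obtain ⟨i, hi⟩ := hK.elim_directed_cover (fun i => {x | (u x : ℝ≥0∞) < g i x + η}) hopen (by
    intro x _
    rw [mem_iUnion]
    have h1 : (u x : ℝ≥0∞) ≤ ⨆ i, g i x :=
      (ENNReal.coe_le_coe.2 (hus x)).trans (hs x)
    rcases eq_or_ne (u x) 0 with h0 | h0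
    · obtain ⟨i⟩ := ‹Nonempty ι›
      refine ⟨i, ?_⟩
      simp [h0, hη]
    · have h2 : ((u x - η : NNReal) : ℝ≥0∞) < ⨆ i, g i x := by
        refine lt_of_lt_of_le ?_ h1
        exact_mod_cast tsub_lt_self (pos_iff_ne_zero.2 h0) hη
      obtain ⟨i, hi⟩ := lt_iSup_iff.1 h2
      refine ⟨i, ?_⟩
      have h3 : (u x : ℝ≥0∞) ≤ ((u x - η : NNReal) : ℝ≥0∞) + η := by
        exact_mod_cast le_tsub_add
      exact h3.trans_lt (ENNReal.add_lt_add_right (by simp) hi)) (by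
    intro i j
    obtain ⟨k, hik, hjk⟩ := hd i j
    exact ⟨k, fun x hx => lt_of_lt_of_le hx (add_le_add (hik x) le_rfl),
      fun x hx => lt_of_lt_of_le hx (add_le_add (hjk x) le_rfl)⟩)
  have hKm := hK.measurableSet
  have h1 : ∫⁻ x, (u x : ℝ≥0∞) ∂μ ≤ (∫⁻ x, g i x ∂μ) + ε / 3 + ε / 3 := by
    rw [← lintegral_add_compl _ hKm]
    refine add_le_add ?_ ?_
    · calc ∫⁻ x in K, (u x : ℝ≥0∞) ∂μ ≤ ∫⁻ x in K, (g i x + η) ∂μ :=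
            setLIntegral_mono' hKm fun x hx => (hi hx).le
        _ ≤ ∫⁻ x, (g i x + η) ∂μ := setLIntegral_le_lintegral _ _
        _ = (∫⁻ x, g i x ∂μ) + η * μ univ := by
            rw [lintegral_add_right _ measurable_const, lintegral_const]
        _ ≤ _ := by gcongr
    · calc ∫⁻ x in Kᶜ, (u x : ℝ≥0∞) ∂μ ≤ ∫⁻ x in Kᶜ, (C : ℝ≥0∞) ∂μ :=
            lintegral_mono fun x => (ENNReal.coe_le_coe.2 (hus x)).trans (hsC x)
        _ = (C : ℝ≥0∞) * μ Kᶜ := by simp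
        _ ≤ (C : ℝ≥0∞) * δ := by
            gcongr
            rw [compl_eq_univ_sdiff]
            exact hKδ.le
        _ ≤ _ := by rw [mul_comm]; exact hδ'.le
  calc ∫⁻ x, (s x : ℝ≥0∞) ∂μ ≤ (∫⁻ x, (u x : ℝ≥0∞) ∂μ) + ε / 3 := hui
    _ ≤ (∫⁻ x, g i x ∂μ) + ε / 3 + ε / 3 + ε / 3 := by gcongr
    _ = (∫⁻ x, g i x ∂μ) + ε := by
        rw [add_assoc, add_assoc, ← add_assoc (_ / 3), ENNReal.add_thirds]
    _ ≤ _ := by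
        gcongr
        exact le_iSup (fun i => ∫⁻ x, g i x ∂μ) i

end Semicontinuous
section CompactlySupportedMinorants

variable {Y : Type*} [TopologicalSpace Y] [MeasurableSpace Y]

/-- The nonnegative, continuous, measurable, compactly supported functions below `g`. -/
def minorants (g : Y → ℝ≥0∞) : Set (Y → ℝ) :=
  {φ | Continuous φ ∧ HasCompactSupport φ ∧ Measurable φ ∧ (∀ y, 0 ≤ φ y) ∧
    ∀ y, ENNReal.ofReal (φ y) ≤ g y}

/-- Points can be separated from closed sets by compactly supported measurable bump functions. -/
def HasBumps (Y : Type*) [TopologicalSpace Y] [MeasurableSpace Y] : Prop :=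
  ∀ (y : Y) (U : Set Y), IsOpen U → y ∈ U → ∃ φ : Y → ℝ, Continuous φ ∧ HasCompactSupport φ ∧
    Measurable φ ∧ (∀ z, 0 ≤ φ z ∧ φ z ≤ 1) ∧ φ y = 1 ∧ ∀ z, z ∉ U → φ z = 0

instance (g : Y → ℝ≥0∞) : Nonempty (minorants g) :=
  ⟨⟨fun _ => 0, continuous_const, HasCompactSupport.zero, measurable_const, fun _ => le_rfl,
    fun _ => by simp⟩⟩

theorem sup_mem_minorants [R1Space Y] {g : Y → ℝ≥0∞} {φ ψ : Y → ℝ} (hφ : φ ∈ minorants g)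
    (hψ : ψ ∈ minorants g) : (fun y => max (φ y) (ψ y)) ∈ minorants g := by
  obtain ⟨h1, h2, h3, h4, h5⟩ := hφ
  obtain ⟨k1, k2, k3, k4, k5⟩ := hψ
  refine ⟨h1.max k1, ?_, h3.max k3, fun y => le_max_of_le_left (h4 y), fun y => ?_⟩
  · refine HasCompactSupport.of_support_subset_isCompact (h2.isCompact.union k2.isCompact) ?_
    intro y hy
    by_contra hc
    rw [mem_union, not_or] at hc
    apply hy
    simp [image_eq_zero_of_notMem_tsupport hc.1, image_eq_zero_of_notMem_tsupport hc.2]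
  · rw [ENNReal.ofReal_max]
    exact max_le (h5 y) (k5 y)

theorem directed_minorants [R1Space Y] (g : Y → ℝ≥0∞) :
    Directed (· ≤ ·) fun (φ : minorants g) (y : Y) => ENNReal.ofReal (φ.1 y) := by
  intro φ ψ
  exact ⟨⟨_, sup_mem_minorants φ.2 ψ.2⟩, fun y => ENNReal.ofReal_le_ofReal (le_max_left _ _),
    fun y => ENNReal.ofReal_le_ofReal (le_max_right _ _)⟩

theorem iSup_minorants (hY : HasBumps Y) {g : Y → ℝ≥0∞} (hg : LowerSemicontinuous g) (y : Y) :
    ⨆ φ : minorants g, ENNReal.ofReal (φ.1 y) = g y := by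
  refine le_antisymm (iSup_le fun φ => φ.2.2.2.2.2 y) (le_of_forall_lt fun c hc => ?_)
  obtain ⟨r, hr1, hr2⟩ := ENNReal.lt_iff_exists_nnreal_btwn.1 hc
  obtain ⟨φ, h1, h2, h3, h4, h5, h6⟩ := hY y (g ⁻¹' Ioi (r : ℝ≥0∞)) (hg.isOpen_preimage _) hr2
  refine lt_of_lt_of_le hr1 (le_iSup_of_le (ι := minorants g) ⟨fun z => r * φ z,
    continuous_const.mul h1, h2.mul_left, measurable_const.mul h3,
    fun z => mul_nonneg r.2 (h4 z).1, fun z => ?_⟩ ?_)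
  · by_cases hz : z ∈ g ⁻¹' Ioi (r : ℝ≥0∞)
    · refine le_trans (ENNReal.ofReal_le_ofReal
        (mul_le_of_le_one_right r.2 (h4 z).2)) ?_
      rw [ENNReal.ofReal_coe_nnreal]
      exact le_of_lt hz
    · simp [h6 z hz]
  · simp [h5]

theorem hasBumps [T2Space X] [LocallyCompactSpace X] [BorelSpace X] : HasBumps X := by
  intro x U hU hx
  obtain ⟨φ, h1, h2, h3, h4⟩ := exists_continuous_one_zero_of_isCompact (isCompact_singleton (x := x))
    hU.isClosed_compl (by simpa using hx)
  exact ⟨φ, φ.continuous, h3, φ.continuous.measurable, fun z => h4 z, h1 rfl, fun z hz => h2 hz⟩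

theorem hasBumps_prod [T2Space X] [LocallyCompactSpace X] [BorelSpace X] : HasBumps (X × X) := by
  intro p U hU hp
  obtain ⟨V, W, hV, hW, hpV, hpW, hVW⟩ := isOpen_prod_iff.1 hU p.1 p.2 hp
  obtain ⟨φ, h1, h2, h3, h4, h5, h6⟩ := hasBumps p.1 V hV hpV
  obtain ⟨ψ, k1, k2, k3, k4, k5, k6⟩ := hasBumps p.2 W hW hpW
  refine ⟨fun q => φ q.1 * ψ q.2, by fun_prop, ?_, by fun_prop, fun q => ?_, by simp [h5, k5],
    fun q hq => ?_⟩
  · refine HasCompactSupport.intro (h2.isCompact.prod k2.isCompact) fun q hq => ?_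
    rw [mem_prod, not_and_or] at hq
    rcases hq with hq | hq
    · simp [image_eq_zero_of_notMem_tsupport hq]
    · simp [image_eq_zero_of_notMem_tsupport hq]
  · exact ⟨mul_nonneg (h4 _).1 (k4 _).1, mul_le_one₀ (h4 _).2 (k4 _).1 (k4 _).2⟩
  · by_cases hq1 : q.1 ∈ V
    · have hq2 : q.2 ∉ W := fun h => hq (hVW ⟨hq1, h⟩)
      simp [k6 _ hq2]
    · simp [h6 _ hq1]

theorem lintegral_eq_iSup_minorants [T2Space X] [LocallyCompactSpace X] [BorelSpace X]
    (μ : Measure X) [IsFiniteMeasure μ] [μ.Regular] {g : X → ℝ≥0∞} (hg : LowerSemicontinuous g) :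
    ∫⁻ x, g x ∂μ = ⨆ φ : minorants g, ∫⁻ x, ENNReal.ofReal (φ.1 x) ∂μ := by
  rw [← lintegral_iSup_of_lowerSemicontinuous μ _ _ (directed_minorants g)]
  · exact lintegral_congr fun x => (iSup_minorants hasBumps hg x).symm
  · exact fun φ => (ENNReal.continuous_ofReal.comp φ.2.1).lowerSemicontinuous

end CompactlySupportedMinorants

section Regularity

theorem regular_add [T2Space X] [BorelSpace X] (μ ν : Measure X) [IsFiniteMeasure μ]
    [IsFiniteMeasure ν] [μ.Regular] [ν.Regular] : (μ + ν).Regular := by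
  have : (μ + ν).InnerRegular := ⟨by
    intro s hs r hr
    obtain ⟨ε, hε, hεr⟩ : ∃ ε : ℝ≥0∞, ε ≠ 0 ∧ r + (ε + ε) < (μ + ν) s := by
      obtain ⟨c, hc1, hc2⟩ := exists_between hr
      have hrt : r ≠ ∞ := hr.ne_top
      refine ⟨(c - r) / 2, ?_, ?_⟩
      · exact (ENNReal.half_pos (tsub_pos_of_lt hc1).ne').ne'
      · rw [ENNReal.add_halves, add_tsub_cancel_of_le hc1.le]
        exact hc2
    obtain ⟨K, hKs, hK, hK'⟩ := hs.exists_isCompact_lt_add (measure_ne_top μ s) hε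
    obtain ⟨L, hLs, hL, hL'⟩ := hs.exists_isCompact_lt_add (measure_ne_top ν s) hε
    refine ⟨K ∪ L, union_subset hKs hLs, hK.union hL, ?_⟩
    have h1 : (μ + ν) s ≤ (μ + ν) (K ∪ L) + (ε + ε) := by
      rw [Measure.add_apply, Measure.add_apply, add_add_add_comm]
      exact add_le_add (hK'.le.trans (by gcongr; exact subset_union_left))
        (hL'.le.trans (by gcongr; exact subset_union_right))
    exact lt_of_add_lt_add_right (hεr.trans_le h1)⟩
  infer_instance

/-- The integral of a lower semicontinuous function against a regular measure is exhausted by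
compact sets. -/
theorem lintegral_eq_iSup_isCompact [T2Space X] [BorelSpace X] (μ : Measure X) [μ.Regular]
    {g : X → ℝ≥0∞} (hg : LowerSemicontinuous g) :
    ∫⁻ x, g x ∂μ = ⨆ K : {K : Set X // IsCompact K}, ∫⁻ x in K.1, g x ∂μ := by
  refine le_antisymm ?_ (iSup_le fun K => setLIntegral_le_lintegral _ _)
  have hO : ∀ q : ℝ≥0∞, IsOpen {x | q < g x} := fun q => hg.isOpen_preimage q
  -- a countable family of compact sets exhausting every superlevel set
  have key : ∀ n : ℕ, ∃ K : ℕ → Set X, (∀ m, IsCompact (K m)) ∧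
      ∫⁻ x in {x | (n + 1 : ℝ≥0∞)⁻¹ < g x}, g x ∂μ ≤ ∫⁻ x in ⋃ m, K m, g x ∂μ := by
    intro n
    set q : ℝ≥0∞ := (n + 1 : ℝ≥0∞)⁻¹ with hq
    have hq0 : q ≠ 0 := by simp [hq]
    by_cases hfin : μ {x | q < g x} = ∞
    · have h1 : ∀ m : ℕ, ∃ K ⊆ {x | q < g x}, IsCompact K ∧ (m : ℝ≥0∞) < μ K := fun m =>
        (hO q).exists_lt_isCompact (by rw [hfin]; exact ENNReal.natCast_lt_top m)
      choose K hK1 hK2 hK3 using h1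
      refine ⟨K, hK2, ?_⟩
      have h2 : ∫⁻ x in ⋃ m, K m, g x ∂μ = ∞ := by
        have h3 : ∀ m : ℕ, q * m ≤ ∫⁻ x in ⋃ m, K m, g x ∂μ := fun m => by
          calc q * m ≤ q * μ (K m) := by gcongr; exact (hK3 m).le
            _ = ∫⁻ x in K m, q ∂μ := by simp
            _ ≤ ∫⁻ x in K m, g x ∂μ :=
              setLIntegral_mono' (hK2 m).measurableSet fun x hx => (hK1 m hx).le
            _ ≤ _ := lintegral_mono_set (subset_iUnion K m)
        by_contra hne
        obtain ⟨m, hm⟩ := ENNReal.exists_nat_mul_gt hq0 hne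
        rw [mul_comm] at hm
        exact absurd (h3 m) (not_le.2 hm)
      rw [h2]
      exact le_top
    · have h1 : ∀ m : ℕ, ∃ K ⊆ {x | q < g x}, IsCompact K ∧
          μ ({x | q < g x} \ K) < (m + 1 : ℝ≥0∞)⁻¹ := fun m =>
        (hO q).measurableSet.exists_isCompact_sdiff_lt hfin (by simp)
      choose K hK1 hK2 hK3 using h1
      refine ⟨K, hK2, ?_⟩
      have h4 : μ ({x | q < g x} \ ⋃ m, K m) = 0 := by
        refine le_antisymm (ENNReal.le_of_forall_pos_le_add fun ε hε _ => ?_) bot_le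
        obtain ⟨m, hm⟩ := ENNReal.exists_inv_nat_lt (a := ε) (by exact_mod_cast hε.ne')
        rw [zero_add]
        calc _ ≤ μ ({x | q < g x} \ K m) := by
              gcongr
              exact subset_iUnion K m
          _ ≤ (m + 1 : ℝ≥0∞)⁻¹ := (hK3 m).le
          _ ≤ (m : ℝ≥0∞)⁻¹ := by
              rw [ENNReal.inv_le_inv]
              exact le_self_add
          _ ≤ ε := hm.le
      refine lintegral_mono' (Measure.restrict_mono_ae ?_) le_rfl
      rw [ae_le_set]
      exact h4
  choose K hK1 hK2 using key
  set L : ℕ → Set X := fun n => ⋃ i ∈ Finset.range n, ⋃ j ∈ Finset.range n, K i j with hL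
  have hLc : ∀ n, IsCompact (L n) := fun n =>
    (Finset.range n).isCompact_biUnion fun i _ => (Finset.range n).isCompact_biUnion
      fun j _ => hK1 i j
  have hLm : Monotone L := by
    intro a b hab x hx
    simp only [hL, mem_iUnion, Finset.mem_range] at hx ⊢
    obtain ⟨i, hi, j, hj, hx⟩ := hx
    exact ⟨i, hi.trans_le hab, j, hj.trans_le hab, hx⟩
  have hKL : ∀ n, ⋃ m, K n m ⊆ ⋃ n, L n := by
    intro n x hx
    obtain ⟨m, hm⟩ := mem_iUnion.1 hx
    refine mem_iUnion.2 ⟨max n m + 1, ?_⟩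
    simp only [hL, mem_iUnion, Finset.mem_range]
    exact ⟨n, by omega, m, by omega, hm⟩
  have hmono : Monotone fun n : ℕ => {x | (n + 1 : ℝ≥0∞)⁻¹ < g x} := by
    intro a b hab x hx
    refine lt_of_le_of_lt ?_ (show (a + 1 : ℝ≥0∞)⁻¹ < g x from hx)
    rw [ENNReal.inv_le_inv]
    gcongr
  have hsupp : ∫⁻ x, g x ∂μ = ∫⁻ x in ⋃ n : ℕ, {x | (n + 1 : ℝ≥0∞)⁻¹ < g x}, g x ∂μ := by
    symm
    refine setLIntegral_eq_of_support_subset fun x hx => ?_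
    obtain ⟨n, hn⟩ := ENNReal.exists_inv_nat_lt (a := g x) hx
    refine mem_iUnion.2 ⟨n, lt_of_le_of_lt ?_ hn⟩
    rw [ENNReal.inv_le_inv]
    exact le_self_add
  rw [hsupp, setLIntegral_iUnion_of_directed _ hmono.directed_le]
  refine iSup_le fun n => (hK2 n).trans ((lintegral_mono_set (hKL n)).trans ?_)
  rw [setLIntegral_iUnion_of_directed _ hLm.directed_le]
  exact iSup_le fun n => le_iSup (fun K : {K : Set X // IsCompact K} => ∫⁻ x in K.1, g x ∂μ)
    ⟨L n, hLc n⟩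

end Regularity

section Potentials

theorem continuous_lintegral_of_hasCompactSupport {Y : Type*} [TopologicalSpace Y]
    [R1Space X] [OpensMeasurableSpace X] (ν : Measure X) [IsFiniteMeasureOnCompacts ν] {h : Y × X → ℝ}
    (hc : Continuous h) (hs : HasCompactSupport h) (h0 : ∀ p, 0 ≤ h p) :
    Continuous fun x => ∫⁻ y, ENNReal.ofReal (h (x, y)) ∂ν := by
  have hz : ∀ (p : Y) (x : X), x ∉ Prod.snd '' tsupport h → h (p, x) = 0 := fun p x hx =>
    image_eq_zero_of_notMem_tsupport fun hp => hx ⟨_, hp, rfl⟩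
  have hK : IsCompact (Prod.snd '' tsupport h) := hs.isCompact.image continuous_snd
  have h1 : Continuous fun x => ∫ y, h (x, y) ∂ν := by
    rw [← continuousOn_univ]
    exact continuousOn_integral_of_compact_support hK hc.continuousOn fun p x _ hx => hz p x hx
  have h2 : ∀ x, ∫⁻ y, ENNReal.ofReal (h (x, y)) ∂ν = ENNReal.ofReal (∫ y, h (x, y) ∂ν) := by
    intro x
    rw [ofReal_integral_eq_lintegral_ofReal _ (ae_of_all _ fun y => h0 _)]
    exact (hc.comp (by fun_prop : Continuous fun y => (x, y))).integrable_of_hasCompactSupport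
      (HasCompactSupport.intro hK fun y hy => hz x y hy)
  simp_rw [h2]
  exact ENNReal.continuous_ofReal.comp h1

variable [T2Space X] [LocallyCompactSpace X] [BorelSpace X] {κ : X → X → ℝ≥0∞}

theorem potential_eq_iSup_minorants (hκ : LowerSemicontinuous fun p : X × X => κ p.1 p.2)
    (ν : Measure X) [IsFiniteMeasure ν] [ν.Regular] (x : X) :
    potential κ ν x = ⨆ h : minorants fun p : X × X => κ p.1 p.2,
      ∫⁻ y, ENNReal.ofReal (h.1 (x, y)) ∂ν := by
  rw [← lintegral_iSup_of_lowerSemicontinuous ν]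
  · exact lintegral_congr fun y => (iSup_minorants hasBumps_prod hκ (x, y)).symm
  · intro h
    exact (ENNReal.continuous_ofReal.comp (h.2.1.comp (by fun_prop))).lowerSemicontinuous
  · intro h k
    obtain ⟨l, hl, hl'⟩ := directed_minorants _ h k
    exact ⟨l, fun y => hl (x, y), fun y => hl' (x, y)⟩

theorem lowerSemicontinuous_potential (hκ : LowerSemicontinuous fun p : X × X => κ p.1 p.2)
    (ν : Measure X) [IsFiniteMeasure ν] [ν.Regular] : LowerSemicontinuous (potential κ ν) := by
  rw [show potential κ ν = _ from funext (potential_eq_iSup_minorants hκ ν)]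
  exact lowerSemicontinuous_iSup fun h => (continuous_lintegral_of_hasCompactSupport ν h.2.1 h.2.2.1
    h.2.2.2.2.1).lowerSemicontinuous

theorem lintegral_potential (hκ : LowerSemicontinuous fun p : X × X => κ p.1 p.2)
    (μ ν : Measure X) [IsFiniteMeasure μ] [μ.Regular] [IsFiniteMeasure ν] [ν.Regular] :
    ∫⁻ x, potential κ ν x ∂μ = mutualEnergy κ μ ν := by
  refine le_antisymm ?_ (lintegral_prod_le _)
  rw [lintegral_congr (potential_eq_iSup_minorants hκ ν), lintegral_iSup_of_lowerSemicontinuous μ]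
  · refine iSup_le fun h => ?_
    rw [← lintegral_prod _ (h.2.2.2.1.ennreal_ofReal.aemeasurable)]
    exact lintegral_mono h.2.2.2.2.2
  · exact fun h => (continuous_lintegral_of_hasCompactSupport ν h.2.1 h.2.2.1
      h.2.2.2.2.1).lowerSemicontinuous
  · intro h k
    obtain ⟨l, hl, hl'⟩ := directed_minorants _ h k
    exact ⟨l, fun x => lintegral_mono fun y => hl (x, y), fun x => lintegral_mono fun y => hl' (x, y)⟩

end Potentials

section MutualEnergy

variable {Z : Type*} [MeasurableSpace Z] {κ : Z → Z → ℝ≥0∞}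

theorem mutualEnergy_comm (hκ : ∀ x y, κ x y = κ y x) (μ ν : Measure Z) [IsFiniteMeasure μ]
    [IsFiniteMeasure ν] : mutualEnergy κ μ ν = mutualEnergy κ ν μ := by
  rw [mutualEnergy, ← lintegral_prod_swap]
  exact lintegral_congr fun p => hκ _ _

theorem mutualEnergy_add_left (μ μ' ν : Measure Z) [IsFiniteMeasure μ] [IsFiniteMeasure μ']
    [IsFiniteMeasure ν] : mutualEnergy κ (μ + μ') ν = mutualEnergy κ μ ν + mutualEnergy κ μ' ν := by
  rw [mutualEnergy, Measure.add_prod, lintegral_add_measure]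
  rfl

theorem mutualEnergy_add_right (μ ν ν' : Measure Z) [IsFiniteMeasure μ] [IsFiniteMeasure ν]
    [IsFiniteMeasure ν'] : mutualEnergy κ μ (ν + ν') = mutualEnergy κ μ ν + mutualEnergy κ μ ν' := by
  rw [mutualEnergy, Measure.prod_add, lintegral_add_measure]
  rfl

theorem mutualEnergy_smul_left (c : NNReal) (μ ν : Measure Z) [IsFiniteMeasure ν] :
    mutualEnergy κ (c • μ) ν = c * mutualEnergy κ μ ν := by
  rw [mutualEnergy, Measure.prod_smul_left, lintegral_smul_measure]
  rfl

theorem mutualEnergy_smul_right (c : NNReal) (μ ν : Measure Z) [IsFiniteMeasure ν] :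
    mutualEnergy κ μ (c • ν) = c * mutualEnergy κ μ ν := by
  rw [mutualEnergy, Measure.prod_smul_right, lintegral_smul_measure]
  rfl

theorem mutualEnergy_zero_right (μ : Measure Z) : mutualEnergy κ μ 0 = 0 := by
  simp [mutualEnergy]

theorem energy_add (hκ : ∀ x y, κ x y = κ y x) (μ ν : Measure Z) [IsFiniteMeasure μ]
    [IsFiniteMeasure ν] :
    energy κ (μ + ν) = energy κ μ + energy κ ν + 2 * mutualEnergy κ μ ν := by
  rw [energy, mutualEnergy_add_left, mutualEnergy_add_right, mutualEnergy_add_right,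
    mutualEnergy_comm hκ ν μ, energy, energy]
  ring

theorem energy_smul (c : NNReal) (μ : Measure Z) [IsFiniteMeasure μ] :
    energy κ (c • μ) = c ^ 2 * energy κ μ := by
  rw [energy, mutualEnergy_smul_left, mutualEnergy_smul_right, energy]
  ring

/-- The squared strong distance. -/
def sqDist (κ : Z → Z → ℝ≥0∞) (μ ν : Measure Z) : ℝ :=
  (energy κ μ).toReal + (energy κ ν).toReal - 2 * (mutualEnergy κ μ ν).toReal

theorem sqDist_comm (hκ : ∀ x y, κ x y = κ y x) (μ ν : Measure Z) [IsFiniteMeasure μ]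
    [IsFiniteMeasure ν] : sqDist κ μ ν = sqDist κ ν μ := by
  rw [sqDist, sqDist, mutualEnergy_comm hκ]
  ring

end MutualEnergy

section FiniteEnergy

variable {κ : X → X → ℝ≥0∞}

/-- Finite Radon measures of finite energy. -/
structure FiniteEnergy (κ : X → X → ℝ≥0∞) (μ : Measure X) : Prop where
  regular : μ.Regular
  isFiniteMeasure : IsFiniteMeasure μ
  energy_lt_top : energy κ μ < ⊤

theorem FiniteEnergy.memEplus {μ : Measure X} (h : FiniteEnergy κ μ) : memEplus κ μ :=
  ⟨h.regular, h.energy_lt_top⟩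

theorem memBreve.finiteEnergy {A : Set X} {μ : Measure X} (h : memBreve κ A μ) :
    FiniteEnergy κ μ :=
  ⟨h.1.1, ⟨by rw [h.2.2]; exact one_lt_top⟩, h.1.2⟩

theorem memEplus_zero : memEplus κ (0 : Measure X) :=
  ⟨Measure.Regular.zero, by simp [energy, mutualEnergy]⟩

theorem EnergyPrinciple.eq_zero (hE : EnergyPrinciple κ) {μ : Measure X} (h : memEplus κ μ)
    (h0 : energy κ μ = 0) : μ = 0 := by
  refine (hE μ 0 h memEplus_zero).2 ?_
  rw [h0, mutualEnergy_zero_right]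
  simp [energy, mutualEnergy]

theorem EnergyPrinciple.mutualEnergy_ne_top (hE : EnergyPrinciple κ) {μ ν : Measure X}
    (hμ : memEplus κ μ) (hν : memEplus κ ν) : mutualEnergy κ μ ν ≠ ⊤ := by
  have h := (hE μ ν hμ hν).1
  have h2 : 2 * mutualEnergy κ μ ν < ⊤ := h.trans_lt (add_lt_top.2 ⟨hμ.2, hν.2⟩)
  intro h3
  simp [h3] at h2

theorem EnergyPrinciple.energy_restrict_le [T2Space X] [BorelSpace X] (hE : EnergyPrinciple κ)
    {ϑ : Measure X} (hϑ : memEplus κ ϑ) {K : Set X} (hK : IsCompact K) :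
    energy κ (ϑ.restrict K) ≤ energy κ ϑ := by
  have : ϑ.Regular := hϑ.1
  have hfin : IsFiniteMeasure (ϑ.restrict K) := ⟨by simpa using hK.measure_lt_top⟩
  by_cases hm : AEMeasurable (fun x => Measure.map (Prod.mk x) ϑ) ϑ
  · refine lintegral_mono' (Measure.le_iff.2 fun s hs => ?_) le_rfl
    rw [Measure.prod_apply hs, Measure.prod, Measure.bind_apply hs hm]
    refine lintegral_mono' Measure.restrict_le_self fun x => ?_
    rw [Measure.map_apply measurable_prodMk_left hs]
    exact Measure.restrict_le_self _
  · have h0 : ϑ.prod ϑ = 0 := by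
      rw [Measure.prod, Measure.bind, Measure.map_of_not_aemeasurable hm, Measure.join_zero]
    have h1 : ϑ = 0 := hE.eq_zero hϑ (by simp [energy, mutualEnergy, h0])
    simp [h1]

theorem EnergyPrinciple.finiteEnergy_restrict [T2Space X] [BorelSpace X] (hE : EnergyPrinciple κ)
    {ϑ : Measure X} (hϑ : GaussVar.memEplus κ ϑ) {K : Set X} (hK : IsCompact K) :
    FiniteEnergy κ (ϑ.restrict K) := by
  have : ϑ.Regular := hϑ.1
  exact ⟨Measure.Regular.restrict_of_measure_ne_top hK.measure_ne_top,
    ⟨by simpa using hK.measure_lt_top⟩, (hE.energy_restrict_le hϑ hK).trans_lt hϑ.2⟩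

theorem FiniteEnergy.smul {μ : Measure X} (h : FiniteEnergy κ μ) (c : NNReal) :
    FiniteEnergy κ (c • μ) := by
  have := h.regular
  have := h.isFiniteMeasure
  refine ⟨inferInstance, inferInstance, ?_⟩
  rw [energy_smul]
  exact mul_lt_top (by finiteness) h.energy_lt_top

theorem FiniteEnergy.add [T2Space X] [BorelSpace X] (hκ : ∀ x y, κ x y = κ y x)
    (hE : EnergyPrinciple κ) {μ ν : Measure X} (hμ : FiniteEnergy κ μ) (hν : FiniteEnergy κ ν) :
    FiniteEnergy κ (μ + ν) := by
  have := hμ.regular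
  have := hμ.isFiniteMeasure
  have := hν.regular
  have := hν.isFiniteMeasure
  refine ⟨regular_add μ ν, inferInstance, ?_⟩
  rw [energy_add hκ]
  have h1 := hμ.energy_lt_top
  have h2 := hν.energy_lt_top
  have h3 := hE.mutualEnergy_ne_top hμ.memEplus hν.memEplus
  finiteness

theorem EnergyPrinciple.sqDist_nonneg (hE : EnergyPrinciple κ) {μ ν : Measure X}
    (hμ : memEplus κ μ) (hν : memEplus κ ν) : 0 ≤ sqDist κ μ ν := by
  have h := ENNReal.toReal_mono (add_lt_top.2 ⟨hμ.2, hν.2⟩).ne (hE μ ν hμ hν).1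
  rw [ENNReal.toReal_add hμ.2.ne hν.2.ne, ENNReal.toReal_mul] at h
  simp only [toReal_ofNat] at h
  rw [sqDist]
  linarith

theorem EnergyPrinciple.eq_of_sqDist_nonpos (hE : EnergyPrinciple κ) {μ ν : Measure X}
    (hμ : memEplus κ μ) (hν : memEplus κ ν) (h : sqDist κ μ ν ≤ 0) : μ = ν := by
  refine (hE μ ν hμ hν).2 ?_
  have h0 := hE.sqDist_nonneg hμ hν
  have h1 := hE.mutualEnergy_ne_top hμ hν
  rw [sqDist] at h h0
  rw [← ENNReal.toReal_eq_toReal_iff' (mul_ne_top ofNat_ne_top h1) (add_lt_top.2 ⟨hμ.2, hν.2⟩).ne,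
    ENNReal.toReal_add hμ.2.ne hν.2.ne, ENNReal.toReal_mul]
  simp only [toReal_ofNat]
  linarith

theorem sqDist_add_smul (hκ : ∀ x y, κ x y = κ y x) (hE : EnergyPrinciple κ) {m m' t : Measure X}
    (hm : FiniteEnergy κ m) (hm' : FiniteEnergy κ m') (ht : FiniteEnergy κ t) (s : NNReal) :
    sqDist κ (m + s • t) m' = (energy κ t).toReal * (s * s) +
      2 * ((mutualEnergy κ m t).toReal - (mutualEnergy κ m' t).toReal) * s + sqDist κ m m' := by
  have := hm.isFiniteMeasure
  have := hm'.isFiniteMeasure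
  have := ht.isFiniteMeasure
  have h1 := hE.mutualEnergy_ne_top hm.memEplus ht.memEplus
  have h2 := hE.mutualEnergy_ne_top hm'.memEplus ht.memEplus
  have h3 := hE.mutualEnergy_ne_top hm.memEplus hm'.memEplus
  have h4 := hm.energy_lt_top.ne
  have h5 := ht.energy_lt_top.ne
  rw [sqDist, sqDist, energy_add hκ, energy_smul, mutualEnergy_add_left, mutualEnergy_smul_left,
    mutualEnergy_smul_right, mutualEnergy_comm hκ t m']
  rw [ENNReal.toReal_add (by finiteness) (by finiteness),
    ENNReal.toReal_add (by finiteness) (by finiteness),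
    ENNReal.toReal_add (by finiteness) (by finiteness)]
  simp only [ENNReal.toReal_mul, toReal_ofNat, ENNReal.toReal_pow, coe_toReal]
  ring

variable [T2Space X] [BorelSpace X]

/-- The Cauchy-Schwarz inequality for the difference of two measures. -/
theorem sq_mutualEnergy_sub_le (hκ : ∀ x y, κ x y = κ y x) (hE : EnergyPrinciple κ)
    {m m' t : Measure X} (hm : FiniteEnergy κ m) (hm' : FiniteEnergy κ m')
    (ht : FiniteEnergy κ t) :
    ((mutualEnergy κ m t).toReal - (mutualEnergy κ m' t).toReal) ^ 2 ≤
      (energy κ t).toReal * sqDist κ m m' := by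
  have := hm.isFiniteMeasure
  have := hm'.isFiniteMeasure
  have key : ∀ s : ℝ, 0 ≤ (energy κ t).toReal * (s * s) +
      2 * ((mutualEnergy κ m t).toReal - (mutualEnergy κ m' t).toReal) * s + sqDist κ m m' := by
    intro s
    rcases le_total 0 s with hs | hs
    · lift s to NNReal using hs
      rw [← sqDist_add_smul hκ hE hm hm' ht s]
      exact hE.sqDist_nonneg (hm.add hκ hE (ht.smul s)).memEplus hm'.memEplus
    · obtain ⟨r, rfl⟩ : ∃ r : NNReal, s = -r := 
        ⟨(-s).toNNReal, by rw [Real.coe_toNNReal _ (by linarith), neg_neg]⟩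
      have h := hE.sqDist_nonneg (hm'.add hκ hE (ht.smul r)).memEplus hm.memEplus
      rw [sqDist_add_smul hκ hE hm' hm ht r, sqDist_comm hκ] at h
      linarith
  have h := discrim_le_zero key
  rw [discrim] at h
  linarith

end FiniteEnergy

section PotentialIntegrals

variable {κ : X → X → ℝ≥0∞}

theorem directed_potential_restrict (ϑ : Measure X) :
    Directed (· ≤ ·) fun K : {K : Set X // IsCompact K} => potential κ (ϑ.restrict K.1) :=
  fun K L => ⟨⟨K ∪ L, K.2.union L.2⟩, fun _ => lintegral_mono_set subset_union_left,
    fun _ => lintegral_mono_set subset_union_right⟩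

variable [T2Space X] [BorelSpace X]

theorem potential_eq_iSup_restrict (hκ : LowerSemicontinuous fun p : X × X => κ p.1 p.2)
    (ϑ : Measure X) [ϑ.Regular] (x : X) :
    potential κ ϑ x = ⨆ K : {K : Set X // IsCompact K}, potential κ (ϑ.restrict K.1) x :=
  lintegral_eq_iSup_isCompact ϑ (hκ.comp (by fun_prop : Continuous fun y => (x, y)))

variable [LocallyCompactSpace X]

theorem lowerSemicontinuous_potential_restrict
    (hκ : LowerSemicontinuous fun p : X × X => κ p.1 p.2) (ϑ : Measure X) [ϑ.Regular]
    (K : {K : Set X // IsCompact K}) : LowerSemicontinuous (potential κ (ϑ.restrict K.1)) := by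
  have : (ϑ.restrict K.1).Regular :=
    Measure.Regular.restrict_of_measure_ne_top K.2.measure_ne_top
  have : IsFiniteMeasure (ϑ.restrict K.1) := ⟨by simpa using K.2.measure_lt_top⟩
  exact lowerSemicontinuous_potential hκ _

theorem lowerSemicontinuous_potential_of_regular
    (hκ : LowerSemicontinuous fun p : X × X => κ p.1 p.2) (ϑ : Measure X) [ϑ.Regular] :
    LowerSemicontinuous (potential κ ϑ) := by
  rw [show potential κ ϑ = _ from funext (potential_eq_iSup_restrict hκ ϑ)]
  exact lowerSemicontinuous_iSup (lowerSemicontinuous_potential_restrict hκ ϑ)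

theorem lintegral_potential_eq_iSup (hκ : LowerSemicontinuous fun p : X × X => κ p.1 p.2)
    (μ ϑ : Measure X) [IsFiniteMeasure μ] [μ.Regular] [ϑ.Regular] :
    ∫⁻ x, potential κ ϑ x ∂μ =
      ⨆ K : {K : Set X // IsCompact K}, mutualEnergy κ μ (ϑ.restrict K.1) := by
  have : Nonempty {K : Set X // IsCompact K} := ⟨⟨∅, isCompact_empty⟩⟩
  rw [lintegral_congr (potential_eq_iSup_restrict hκ ϑ),
    lintegral_iSup_of_lowerSemicontinuous μ _ (lowerSemicontinuous_potential_restrict hκ ϑ)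
      (directed_potential_restrict ϑ)]
  refine iSup_congr fun K => ?_
  have : (ϑ.restrict K.1).Regular :=
    Measure.Regular.restrict_of_measure_ne_top K.2.measure_ne_top
  have : IsFiniteMeasure (ϑ.restrict K.1) := ⟨by simpa using K.2.measure_lt_top⟩
  exact lintegral_potential hκ _ _

theorem two_mul_lintegral_potential_le (hκ : LowerSemicontinuous fun p : X × X => κ p.1 p.2)
    (hE : EnergyPrinciple κ) {μ ϑ : Measure X} (hμ : FiniteEnergy κ μ) (hϑ : memEplus κ ϑ) :
    2 * ∫⁻ x, potential κ ϑ x ∂μ ≤ energy κ μ + energy κ ϑ := by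
  have := hμ.isFiniteMeasure
  have := hμ.regular
  have : ϑ.Regular := hϑ.1
  rw [lintegral_potential_eq_iSup hκ, ENNReal.mul_iSup]
  refine iSup_le fun K => ?_
  refine (hE _ _ hμ.memEplus (hE.finiteEnergy_restrict hϑ K.2).memEplus).1.trans ?_
  gcongr
  exact hE.energy_restrict_le hϑ K.2

theorem lintegral_potential_ne_top (hκ : LowerSemicontinuous fun p : X × X => κ p.1 p.2)
    (hE : EnergyPrinciple κ) {μ ϑ : Measure X} (hμ : FiniteEnergy κ μ) (hϑ : memEplus κ ϑ) :
    ∫⁻ x, potential κ ϑ x ∂μ ≠ ⊤ := by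
  intro h
  have h1 := (two_mul_lintegral_potential_le hκ hE hμ hϑ).trans_lt
    (add_lt_top.2 ⟨hμ.energy_lt_top, hϑ.2⟩)
  simp [h] at h1

theorem toReal_lintegral_potential_le (hκ : IsKernel κ) (hE : EnergyPrinciple κ)
    {m m' ϑ : Measure X} (hm : FiniteEnergy κ m) (hm' : FiniteEnergy κ m') (hϑ : memEplus κ ϑ) :
    (∫⁻ x, potential κ ϑ x ∂m).toReal ≤ (∫⁻ x, potential κ ϑ x ∂m').toReal +
      √((energy κ ϑ).toReal * sqDist κ m m') := by
  have := hm.isFiniteMeasure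
  have := hm.regular
  have := hm'.isFiniteMeasure
  have := hm'.regular
  have : ϑ.Regular := hϑ.1
  refine ENNReal.toReal_le_of_le_ofReal (by positivity) ?_
  rw [lintegral_potential_eq_iSup hκ.2 m]
  refine iSup_le fun K => ?_
  have hK := hE.finiteEnergy_restrict hϑ K.2
  have h1 : (mutualEnergy κ m (ϑ.restrict K.1)).toReal - (mutualEnergy κ m' (ϑ.restrict K.1)).toReal
      ≤ √((energy κ ϑ).toReal * sqDist κ m m') := by
    refine Real.le_sqrt_of_sq_le ((sq_mutualEnergy_sub_le hκ.1 hE hm hm' hK).trans ?_)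
    gcongr
    · exact hE.sqDist_nonneg hm.memEplus hm'.memEplus
    · exact hϑ.2.ne
    · exact hE.energy_restrict_le hϑ K.2
  have h2 : (mutualEnergy κ m' (ϑ.restrict K.1)).toReal ≤ (∫⁻ x, potential κ ϑ x ∂m').toReal := by
    refine ENNReal.toReal_mono (lintegral_potential_ne_top hκ.2 hE hm' hϑ) ?_
    rw [lintegral_potential_eq_iSup hκ.2 m']
    exact le_iSup (fun K : {K : Set X // IsCompact K} => mutualEnergy κ m' (ϑ.restrict K.1)) K
  rw [← ENNReal.ofReal_toReal (hE.mutualEnergy_ne_top hm.memEplus hK.memEplus)]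
  exact ENNReal.ofReal_le_ofReal (by linarith)

theorem tendsto_lintegral_potential (hκ : IsKernel κ) (hE : EnergyPrinciple κ)
    {μ : ℕ → Measure X} {μ₀ ϑ : Measure X} (hμ : ∀ n, FiniteEnergy κ (μ n))
    (hμ₀ : FiniteEnergy κ μ₀) (hϑ : memEplus κ ϑ)
    (h : Tendsto (fun n => sqDist κ (μ n) μ₀) atTop (𝓝 0)) :
    Tendsto (fun n => (∫⁻ x, potential κ ϑ x ∂(μ n)).toReal) atTop
      (𝓝 (∫⁻ x, potential κ ϑ x ∂μ₀).toReal) := by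
  have h1 : Tendsto (fun n => √((energy κ ϑ).toReal * sqDist κ (μ n) μ₀)) atTop (𝓝 0) := by
    have := (Real.continuous_sqrt.tendsto _).comp (h.const_mul (energy κ ϑ).toReal)
    simpa [Function.comp_def] using this
  rw [tendsto_iff_dist_tendsto_zero]
  refine squeeze_zero (fun n => dist_nonneg) (fun n => ?_) h1
  have := (hμ n).isFiniteMeasure
  have := hμ₀.isFiniteMeasure
  rw [Real.dist_eq, abs_le]
  have h2 := toReal_lintegral_potential_le hκ hE (hμ n) hμ₀ hϑ
  have h3 := toReal_lintegral_potential_le hκ hE hμ₀ (hμ n) hϑ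
  rw [sqDist_comm hκ.1] at h3
  constructor <;> linarith

theorem tendsto_energy (hκ : IsKernel κ) (hE : EnergyPrinciple κ)
    {μ : ℕ → Measure X} {μ₀ : Measure X} (hμ : ∀ n, FiniteEnergy κ (μ n))
    (hμ₀ : FiniteEnergy κ μ₀) (h : Tendsto (fun n => sqDist κ (μ n) μ₀) atTop (𝓝 0)) :
    Tendsto (fun n => (energy κ (μ n)).toReal) atTop (𝓝 (energy κ μ₀).toReal) := by
  have h1 := tendsto_lintegral_potential hκ hE hμ hμ₀ hμ₀.memEplus h
  have h2 : ∀ n, ∫⁻ x, potential κ μ₀ x ∂(μ n) = mutualEnergy κ (μ n) μ₀ := fun n => by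
    have := (hμ n).isFiniteMeasure
    have := (hμ n).regular
    have := hμ₀.isFiniteMeasure
    have := hμ₀.regular
    exact lintegral_potential hκ.2 _ _
  have h3 : ∫⁻ x, potential κ μ₀ x ∂μ₀ = energy κ μ₀ := by
    have := hμ₀.isFiniteMeasure
    have := hμ₀.regular
    exact lintegral_potential hκ.2 _ _
  simp_rw [h2, h3] at h1
  have h4 := (h.add (h1.const_mul 2)).sub_const (energy κ μ₀).toReal
  convert h4 using 2 with n
  · rw [sqDist]
    ring
  · ring

end PotentialIntegrals

section ExternalField

variable {κ : X → X → ℝ≥0∞} {f : X → EReal}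

theorem exists_real_lowerBound {Y : Type*} [TopologicalSpace Y] {ψ : Y → EReal} (hψ : LowerSemicontinuous ψ) (hbot : ∀ x, ψ x ≠ ⊥)
    (hnc : ¬ CompactSpace Y → ∀ x, 0 ≤ ψ x) : ∃ c : ℝ, ∀ x, ((-c : ℝ) : EReal) ≤ ψ x := by
  by_cases hX : CompactSpace Y
  · rcases isEmpty_or_nonempty Y with hemp | hne
    · exact ⟨0, fun x => (hemp.false x).elim⟩
    · obtain ⟨x₀, -, hx₀⟩ := (hψ.lowerSemicontinuousOn univ).exists_isMinOn univ_nonempty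
        isCompact_univ
      refine ⟨-(ψ x₀).toReal, fun x => le_trans ?_ (hx₀ (mem_univ x))⟩
      rw [neg_neg]
      exact EReal.coe_toReal_le (hbot x₀)
  · exact ⟨0, fun x => by simpa using hnc hX x⟩

theorem IsExternalField.exists_decomposition (hf : IsExternalField κ f) :
    ∃ (g : X → ℝ≥0∞) (c : ℝ) (ϑp ϑm : Measure X), LowerSemicontinuous g ∧ memEplus κ ϑp ∧
      memEplus κ ϑm ∧
      ∀ x, f x = (g x : EReal) - (c : ℝ) + (potential κ ϑp x : EReal) - (potential κ ϑm x : EReal) := by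
  obtain ⟨ψ, ϑp, ϑm, h1, h2, h3, h4, h5, h6⟩ := hf
  obtain ⟨c, hc⟩ := exists_real_lowerBound h1 h2 h3
  refine ⟨fun x => (ψ x + (c : ℝ)).toENNReal, c, ϑp, ϑm, ?_, h4, h5, fun x => ?_⟩
  · refine Continuous.comp_lowerSemicontinuous (g := fun y : EReal => (y + (c : ℝ)).toENNReal) ?_ h1 ?_
    · refine EReal.continuous_toENNReal.comp (continuous_iff_continuousAt.2 fun y => ?_)
      exact (EReal.continuousAt_add (p := (y, ((c : ℝ) : EReal))) (by simp) (by simp)).comp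
        (f := fun y : EReal => (y, ((c : ℝ) : EReal))) (by fun_prop)
    · exact fun a b hab => EReal.toENNReal_le_toENNReal (by gcongr)
  · rw [h6]
    congr 2
    have h7 : 0 ≤ ψ x + (c : ℝ) := by
      have := add_le_add_left (hc x) ((c : ℝ) : EReal)
      rwa [← EReal.coe_add, neg_add_cancel, EReal.coe_zero] at this
    rw [EReal.coe_toENNReal h7]
    generalize ψ x = y
    induction y <;> simp [← EReal.coe_add, ← EReal.coe_sub]

theorem toReal_add_sub {g u v : ℝ≥0∞} {c : ℝ} (hg : g ≠ ⊤) (hu : u ≠ ⊤) (hv : v ≠ ⊤) :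
    (g : EReal) - (c : ℝ) + (u : EReal) - (v : EReal) =
      ((g.toReal - c + u.toReal - v.toReal : ℝ) : EReal) := by
  lift g to NNReal using hg
  lift u to NNReal using hu
  lift v to NNReal using hv
  rfl

theorem ne_top_of_add_sub_ne_top {g u v : ℝ≥0∞} {c : ℝ} (hu : u ≠ ⊤) (hv : v ≠ ⊤)
    (h : (g : EReal) - (c : ℝ) + (u : EReal) - (v : EReal) ≠ ⊤) : g ≠ ⊤ := by
  rintro rfl
  lift u to NNReal using hu
  lift v to NNReal using hv
  exact h rfl

end ExternalField

section FieldIntegral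

variable {Z : Type*} [MeasurableSpace Z] {f : Z → EReal} {g : Z → ℝ≥0∞} {c : ℝ} {u v : Z → ℝ≥0∞}
  {μ : Measure Z}

theorem ae_field_eq (hf : ∀ x, f x = (g x : EReal) - (c : ℝ) + (u x : EReal) - (v x : EReal))
    (hg : AEMeasurable g μ) (hu : AEMeasurable u μ) (hv : AEMeasurable v μ)
    (hgi : ∫⁻ x, g x ∂μ ≠ ⊤) (hui : ∫⁻ x, u x ∂μ ≠ ⊤) (hvi : ∫⁻ x, v x ∂μ ≠ ⊤) :
    ∀ᵐ x ∂μ, f x = (((g x).toReal - c + (u x).toReal - (v x).toReal : ℝ) : EReal) := by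
  filter_upwards [ae_lt_top' hg hgi, ae_lt_top' hu hui, ae_lt_top' hv hvi] with x h1 h2 h3
  rw [hf, toReal_add_sub h1.ne h2.ne h3.ne]

theorem fieldIntegrable_of_lintegral_ne_top [IsFiniteMeasure μ]
    (hf : ∀ x, f x = (g x : EReal) - (c : ℝ) + (u x : EReal) - (v x : EReal))
    (hg : AEMeasurable g μ) (hu : AEMeasurable u μ) (hv : AEMeasurable v μ)
    (hgi : ∫⁻ x, g x ∂μ ≠ ⊤) (hui : ∫⁻ x, u x ∂μ ≠ ⊤) (hvi : ∫⁻ x, v x ∂μ ≠ ⊤) :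
    FieldIntegrable f μ := by
  have h := ae_field_eq hf hg hu hv hgi hui hvi
  constructor
  · have h1 : Integrable (fun x => (g x).toReal - c + (u x).toReal - (v x).toReal) μ :=
      (((integrable_toReal_of_lintegral_ne_top hg hgi).sub (integrable_const c)).add
        (integrable_toReal_of_lintegral_ne_top hu hui)).sub
        (integrable_toReal_of_lintegral_ne_top hv hvi)
    refine h1.congr ?_
    filter_upwards [h] with x hx
    rw [hx, EReal.toReal_coe]
  · filter_upwards [h] with x hx
    rw [hx]
    exact ⟨EReal.coe_ne_top _, EReal.coe_ne_bot _⟩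

theorem fieldIntegral_eq [IsProbabilityMeasure μ]
    (hf : ∀ x, f x = (g x : EReal) - (c : ℝ) + (u x : EReal) - (v x : EReal))
    (hg : AEMeasurable g μ) (hu : AEMeasurable u μ) (hv : AEMeasurable v μ)
    (hgi : ∫⁻ x, g x ∂μ ≠ ⊤) (hui : ∫⁻ x, u x ∂μ ≠ ⊤) (hvi : ∫⁻ x, v x ∂μ ≠ ⊤) :
    fieldIntegral f μ = (∫⁻ x, g x ∂μ).toReal - c + (∫⁻ x, u x ∂μ).toReal -
      (∫⁻ x, v x ∂μ).toReal := by
  have h := ae_field_eq hf hg hu hv hgi hui hvi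
  have i1 := integrable_toReal_of_lintegral_ne_top hg hgi
  have i2 := integrable_toReal_of_lintegral_ne_top hu hui
  have i3 := integrable_toReal_of_lintegral_ne_top hv hvi
  have h1 : fieldIntegral f μ = ∫ x, (g x).toReal - c + (u x).toReal - (v x).toReal ∂μ := by
    refine integral_congr_ae ?_
    filter_upwards [h] with x hx
    rw [hx, EReal.toReal_coe]
  have i0 : Integrable (fun x => (g x).toReal - c) μ := i1.sub (integrable_const c)
  have i4 : Integrable (fun x => (g x).toReal - c + (u x).toReal) μ := i0.add i2
  rw [h1, integral_sub i4 i3, integral_add i0 i2, integral_sub i1 (integrable_const c),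
    integral_toReal hg (ae_lt_top' hg hgi), integral_toReal hu (ae_lt_top' hu hui),
    integral_toReal hv (ae_lt_top' hv hvi)]
  simp

theorem FieldIntegrable.lintegral_ne_top [IsFiniteMeasure μ] (h : FieldIntegrable f μ)
    (hf : ∀ x, f x = (g x : EReal) - (c : ℝ) + (u x : EReal) - (v x : EReal))
    (hu : AEMeasurable u μ) (hv : AEMeasurable v μ)
    (hui : ∫⁻ x, u x ∂μ ≠ ⊤) (hvi : ∫⁻ x, v x ∂μ ≠ ⊤) : ∫⁻ x, g x ∂μ ≠ ⊤ := by
  have h1 : ∀ᵐ x ∂μ, g x =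
      ENNReal.ofReal ((f x).toReal + c - (u x).toReal + (v x).toReal) := by
    filter_upwards [h.2, ae_lt_top' hu hui, ae_lt_top' hv hvi] with x h1 h2 h3
    have h4 : g x ≠ ⊤ := ne_top_of_add_sub_ne_top h2.ne h3.ne (hf x ▸ h1.1)
    rw [hf, toReal_add_sub h4 h2.ne h3.ne, EReal.toReal_coe]
    ring_nf
    rw [ENNReal.ofReal_toReal h4]
  rw [lintegral_congr_ae h1]
  exact (((h.1.add (integrable_const c)).sub
    (integrable_toReal_of_lintegral_ne_top hu hui)).add
    (integrable_toReal_of_lintegral_ne_top hv hvi)).lintegral_lt_top.ne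

end FieldIntegral

section VagueLimits

variable {μ : ℕ → Measure X} {μ₀ : Measure X}

theorem VagueTendstoSeq.tendsto_lintegral [OpensMeasurableSpace X] [∀ n, IsFiniteMeasureOnCompacts (μ n)]
    [IsFiniteMeasureOnCompacts μ₀] (hv : VagueTendstoSeq μ μ₀) {φ : X → ℝ} (hc : Continuous φ)
    (hs : HasCompactSupport φ) (h0 : ∀ x, 0 ≤ φ x) :
    Tendsto (fun n => ∫⁻ x, ENNReal.ofReal (φ x) ∂(μ n)) atTop
      (𝓝 (∫⁻ x, ENNReal.ofReal (φ x) ∂μ₀)) := by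
  have h : ∀ (m : Measure X) [IsFiniteMeasureOnCompacts m],
      ∫⁻ x, ENNReal.ofReal (φ x) ∂m = ENNReal.ofReal (∫ x, φ x ∂m) := fun m _ =>
    (ofReal_integral_eq_lintegral_ofReal (hc.integrable_of_hasCompactSupport hs)
      (ae_of_all _ h0)).symm
  simp_rw [h]
  exact ENNReal.tendsto_ofReal (hv φ hc hs)

variable [T2Space X] [LocallyCompactSpace X] [BorelSpace X]

theorem VagueTendstoSeq.measure_univ_le [∀ n, IsFiniteMeasure (μ n)] [μ₀.Regular]
    (hv : VagueTendstoSeq μ μ₀) {M : ℝ≥0∞} (hM : ∀ n, μ n univ ≤ M) : μ₀ univ ≤ M := by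
  rw [isOpen_univ.measure_eq_iSup_isCompact]
  refine iSup₂_le fun K _ => iSup_le fun hK => ?_
  obtain ⟨φ, h1, -, h3, h4⟩ := exists_continuous_one_zero_of_isCompact hK isClosed_empty
    (disjoint_empty K)
  refine le_trans ?_ (le_of_tendsto' (hv.tendsto_lintegral φ.continuous h3 fun x => (h4 x).1)
    fun n => le_trans ?_ (hM n))
  · rw [← setLIntegral_one]
    refine (setLIntegral_mono' hK.measurableSet fun x hx => ?_).trans (setLIntegral_le_lintegral K _)
    simp [h1 hx]
  · rw [← lintegral_one]
    exact lintegral_mono fun x => by simpa using (h4 x).2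

theorem VagueTendstoSeq.lintegral_le [∀ n, IsFiniteMeasure (μ n)] [IsFiniteMeasure μ₀] [μ₀.Regular]
    (hv : VagueTendstoSeq μ μ₀) {g : X → ℝ≥0∞} (hg : LowerSemicontinuous g) {b : ℕ → ℝ≥0∞}
    {B : ℝ≥0∞} (h : ∀ n, ∫⁻ x, g x ∂(μ n) ≤ b n) (hb : Tendsto b atTop (𝓝 B)) :
    ∫⁻ x, g x ∂μ₀ ≤ B := by
  rw [lintegral_eq_iSup_minorants μ₀ hg]
  exact iSup_le fun φ => le_of_tendsto_of_tendsto'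
    (hv.tendsto_lintegral φ.2.1 φ.2.2.1 φ.2.2.2.2.1) hb
    fun n => (lintegral_mono φ.2.2.2.2.2).trans (h n)

theorem VagueTendstoSeq.le_measure_univ_add [∀ n, IsFiniteMeasure (μ n)]
    [IsFiniteMeasureOnCompacts μ₀] (hv : VagueTendstoSeq μ μ₀) {K : Set X} (hK : IsCompact K)
    {a δ : ℝ≥0∞} (h : ∀ n, a ≤ μ n K + δ) : a ≤ μ₀ univ + δ := by
  obtain ⟨φ, h1, -, h3, h4⟩ := exists_continuous_one_zero_of_isCompact hK isClosed_empty
    (disjoint_empty K)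
  have h5 : a ≤ ∫⁻ x, ENNReal.ofReal (φ x) ∂μ₀ + δ := by
    refine ge_of_tendsto' ((hv.tendsto_lintegral φ.continuous h3 fun x => (h4 x).1).add_const δ)
      fun n => (h n).trans ?_
    gcongr
    rw [← setLIntegral_one]
    refine (setLIntegral_mono' hK.measurableSet fun x hx => ?_).trans (setLIntegral_le_lintegral K _)
    simp [h1 hx]
  refine h5.trans ?_
  gcongr
  rw [← lintegral_one]
  exact lintegral_mono fun x => by simpa using (h4 x).2

end VagueLimits

section Capacity

variable [T2Space X] [BorelSpace X] {κ : X → X → ℝ≥0∞}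

theorem Concentrated.measure_compl_eq_zero {A : Set X} {μ : Measure X} [IsFiniteMeasure μ]
    [μ.Regular] (h : Concentrated μ A) : μ Aᶜ = 0 := by
  refine le_antisymm (ENNReal.le_of_forall_pos_le_add fun ε hε _ => ?_) bot_le
  obtain ⟨C, -, hC, hC'⟩ := MeasurableSet.univ.exists_isCompact_sdiff_lt (measure_ne_top μ univ)
    (ε := ε) (by exact_mod_cast hε.ne')
  calc μ Aᶜ ≤ μ (Aᶜ ∩ C ∪ univ \ C) := measure_mono fun x hx => by
        by_cases hxC : x ∈ C
        · exact Or.inl ⟨hx, hxC⟩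
        · exact Or.inr ⟨mem_univ x, hxC⟩
    _ ≤ μ (Aᶜ ∩ C) + μ (univ \ C) := measure_union_le _ _
    _ ≤ 0 + ε := add_le_add (h C hC).le hC'.le

theorem sq_measure_le_of_innerCap_lt (hE : EnergyPrinciple κ) {μ : Measure X}
    (hμ : FiniteEnergy κ μ) {D C : Set X} (hC : IsCompact C) (hCD : C ⊆ D) {ε : ℝ≥0∞}
    (hD : innerCap κ D < ε) : μ C ^ 2 ≤ ε * energy κ μ := by
  have := hμ.isFiniteMeasure
  rcases eq_or_ne (μ C) 0 with h0 | h0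
  · simp [h0]
  obtain ⟨m, hm⟩ : ∃ m : NNReal, (m : ℝ≥0∞) = μ C := ⟨_, coe_toNNReal (measure_ne_top μ C)⟩
  have hm0 : m ≠ 0 := by
    rintro rfl
    exact h0 hm.symm
  have hν : FiniteEnergy κ (m⁻¹ • μ.restrict C) :=
    (hE.finiteEnergy_restrict hμ.memEplus hC).smul m⁻¹
  have hb : memBreve κ D (m⁻¹ • μ.restrict C) := by
    refine ⟨hν.memEplus, fun K _ => ?_, ?_⟩
    · have h1 : Dᶜ ∩ K ∩ C = ∅ := by
        ext x
        simp only [mem_inter_iff, mem_compl_iff, mem_empty_iff_false, iff_false]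
        exact fun h => h.1.1 (hCD h.2)
      rw [Measure.smul_apply, Measure.restrict_apply' hC.measurableSet, h1]
      simp
    · rw [Measure.smul_apply, Measure.restrict_apply_univ, ← hm, ENNReal.smul_def, smul_eq_mul,
        ← ENNReal.coe_mul, inv_mul_cancel₀ hm0, ENNReal.coe_one]
  have h2 : wcap κ D ≤ ((m⁻¹ : NNReal) : ℝ≥0∞) ^ 2 * energy κ μ := by
    refine (iInf₂_le _ hb).trans ?_
    have : IsFiniteMeasure (μ.restrict C) := inferInstance
    rw [energy_smul]
    gcongr
    exact hE.energy_restrict_le hμ.memEplus hC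
  have hI : energy κ μ ≠ 0 := fun h => h0 (by simp [hE.eq_zero hμ.memEplus h])
  have h3 : (((m⁻¹ : NNReal) : ℝ≥0∞) ^ 2 * energy κ μ)⁻¹ ≤ ε :=
    (ENNReal.inv_le_inv.2 h2).trans hD.le
  rwa [ENNReal.mul_inv (Or.inr hμ.energy_lt_top.ne) (Or.inr hI), ENNReal.coe_inv hm0,
    ENNReal.inv_pow, inv_inv, hm, ← div_eq_mul_inv,
    ENNReal.div_le_iff hI hμ.energy_lt_top.ne] at h3

theorem measure_le_of_innerCap_lt (hE : EnergyPrinciple κ) {μ : Measure X}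
    (hμ : FiniteEnergy κ μ) {D : Set X} (hD : IsOpen D) {ε δ : ℝ≥0∞} (hcap : innerCap κ D < ε)
    (h : ε * energy κ μ ≤ δ ^ 2) : μ D ≤ δ := by
  have := hμ.regular
  rw [hD.measure_eq_iSup_isCompact]
  refine iSup₂_le fun C hCD => iSup_le fun hC => ?_
  exact (ENNReal.pow_le_pow_left_iff two_ne_zero).1
    ((sq_measure_le_of_innerCap_lt hE hμ hC hCD hcap).trans h)

theorem Quasicompact.exists_isCompact_isOpen {A : Set X} (hA : Quasicompact κ A)
    (hE : EnergyPrinciple κ) {M : ℝ≥0∞} (hM : M ≠ ⊤) {δ : NNReal} (hδ : 0 < δ) :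
    ∃ K D : Set X, IsCompact K ∧ IsOpen D ∧ symmDiff A K ⊆ D ∧
      ∀ μ : Measure X, FiniteEnergy κ μ → energy κ μ ≤ M → μ D ≤ δ := by
  have hε : 0 < (δ : ℝ≥0∞) ^ 2 / (M + 1) := by
    refine ENNReal.div_pos ?_ (by finiteness)
    positivity
  obtain ⟨K, hK, hcap⟩ := hA _ hε
  simp only [outerCap, iInf_lt_iff] at hcap
  obtain ⟨D, ⟨hD, hKD⟩, hcap⟩ := hcap
  refine ⟨K, D, hK, hD, hKD, fun μ hμ hle => measure_le_of_innerCap_lt hE hμ hD hcap ?_⟩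
  calc (δ : ℝ≥0∞) ^ 2 / (M + 1) * energy κ μ ≤ (δ : ℝ≥0∞) ^ 2 / (M + 1) * (M + 1) := by
        gcongr
        exact hle.trans le_self_add
    _ = (δ : ℝ≥0∞) ^ 2 := ENNReal.div_mul_cancel (by simp) (by finiteness)

end Capacity

section GaussProblem

variable {κ : X → X → ℝ≥0∞} {f : X → EReal} {A : Set X}

/-- The average of two measures. -/
def midpoint (μ ν : Measure X) : Measure X := (2⁻¹ : NNReal) • (μ + ν)

theorem Admissible.midpoint [T2Space X] [BorelSpace X] (hκ : ∀ x y, κ x y = κ y x)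
    (hE : EnergyPrinciple κ) {μ ν : Measure X} (hμ : Admissible κ A f μ)
    (hν : Admissible κ A f ν) : Admissible κ A f (midpoint μ ν) := by
  refine ⟨⟨((hμ.1.finiteEnergy.add hκ hE hν.1.finiteEnergy).smul _).memEplus, fun K hK => ?_, ?_⟩,
    (hμ.2.1.add_measure hν.2.1).smul_measure_nnreal,
    Measure.ae_smul_measure (ae_add_measure_iff.2 ⟨hμ.2.2, hν.2.2⟩) _⟩
  · simp [GaussVar.midpoint, hμ.1.2.1 K hK, hν.1.2.1 K hK]
  · rw [GaussVar.midpoint, Measure.smul_apply, Measure.add_apply, hμ.1.2.2, hν.1.2.2,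
      ENNReal.smul_def, smul_eq_mul, one_add_one_eq_two, ENNReal.coe_inv two_ne_zero]
    exact ENNReal.inv_mul_cancel two_ne_zero ofNat_ne_top

/-- The parallelogram identity for the Gauss functional. -/
theorem sqDist_eq_gaussI (hκ : ∀ x y, κ x y = κ y x) (hE : EnergyPrinciple κ) {μ ν : Measure X}
    (hμ : Admissible κ A f μ) (hν : Admissible κ A f ν) :
    sqDist κ μ ν = 2 * gaussI κ f μ + 2 * gaussI κ f ν - 4 * gaussI κ f (midpoint μ ν) := by
  have := hμ.1.finiteEnergy.isFiniteMeasure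
  have := hν.1.finiteEnergy.isFiniteMeasure
  have h1 : (energy κ (midpoint μ ν)).toReal = 4⁻¹ * ((energy κ μ).toReal + (energy κ ν).toReal +
      2 * (mutualEnergy κ μ ν).toReal) := by
    have h2 := hE.mutualEnergy_ne_top hμ.1.1 hν.1.1
    have h3 := hμ.1.1.2.ne
    have h4 := hν.1.1.2.ne
    rw [midpoint, energy_smul, energy_add hκ, ENNReal.toReal_mul,
      ENNReal.toReal_add (by finiteness) (by finiteness), ENNReal.toReal_add h3 h4]
    simp only [ENNReal.toReal_mul, toReal_ofNat, ENNReal.toReal_pow, coe_toReal, NNReal.coe_inv,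
      NNReal.coe_ofNat]
    ring
  have h5 : fieldIntegral f (midpoint μ ν) = 2⁻¹ * (fieldIntegral f μ + fieldIntegral f ν) := by
    rw [fieldIntegral, midpoint, integral_smul_nnreal_measure,
      integral_add_measure hμ.2.1 hν.2.1]
    rfl
  rw [gaussI, gaussI, gaussI, h1, h5, sqDist]
  ring

theorem wf_le_gaussI {μ : Measure X} (hμ : Admissible κ A f μ) :
    wf κ A f ≤ ((gaussI κ f μ : ℝ) : EReal) :=
  iInf₂_le μ hμ

theorem sqDist_le_of_gaussI_le [T2Space X] [BorelSpace X] (hκ : ∀ x y, κ x y = κ y x)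
    (hE : EnergyPrinciple κ) {μ ν : Measure X} (hμ : Admissible κ A f μ)
    (hν : Admissible κ A f ν) {w a b : ℝ} (hw : wf κ A f = w) (ha : gaussI κ f μ ≤ w + a)
    (hb : gaussI κ f ν ≤ w + b) : sqDist κ μ ν ≤ 2 * a + 2 * b := by
  have h := wf_le_gaussI (hμ.midpoint hκ hE hν)
  rw [hw, EReal.coe_le_coe_iff] at h
  rw [sqDist_eq_gaussI hκ hE hμ hν]
  linarith

theorem unique_of_isSolution [T2Space X] [BorelSpace X] (hκ : ∀ x y, κ x y = κ y x)
    (hE : EnergyPrinciple κ) {μ ν : Measure X} (hμ : IsSolution κ A f μ)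
    (hν : IsSolution κ A f ν) : μ = ν := by
  refine hE.eq_of_sqDist_nonpos hμ.1.1.1 hν.1.1.1 ?_
  have h := sqDist_le_of_gaussI_le hκ hE hμ.1 hν.1 (a := 0) (b := 0) hμ.2.symm (by simp) ?_
  · simpa using h
  · have := hν.2.trans hμ.2.symm
    rw [EReal.coe_eq_coe_iff] at this
    linarith

theorem exists_minimizing_seq {w : ℝ} (hw : wf κ A f = w) :
    ∃ μ : ℕ → Measure X, ∀ n, Admissible κ A f (μ n) ∧ gaussI κ f (μ n) ≤ w + 1 / (n + 1) := by
  have h : ∀ n : ℕ, ∃ μ : Measure X, Admissible κ A f μ ∧ gaussI κ f μ ≤ w + 1 / (n + 1) := by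
    intro n
    have h1 : wf κ A f < ((w + 1 / (n + 1) : ℝ) : EReal) := by
      rw [hw, EReal.coe_lt_coe_iff]
      have : (0 : ℝ) < 1 / (n + 1) := by positivity
      linarith
    simp only [wf, iInf_lt_iff] at h1
    obtain ⟨μ, hμ, h2⟩ := h1
    exact ⟨μ, hμ, (EReal.coe_lt_coe_iff.1 h2).le⟩
  choose μ hμ using h
  exact ⟨μ, hμ⟩

theorem strongCauchySeq_of_minimizing [T2Space X] [BorelSpace X] (hκ : ∀ x y, κ x y = κ y x)
    (hE : EnergyPrinciple κ) {w : ℝ} (hw : wf κ A f = w) {μ : ℕ → Measure X}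
    (hμ : ∀ n, Admissible κ A f (μ n) ∧ gaussI κ f (μ n) ≤ w + 1 / (n + 1)) :
    StrongCauchySeq κ μ := by
  intro ε hε
  obtain ⟨N, hN⟩ := exists_nat_one_div_lt (show 0 < ε ^ 2 / 4 by positivity)
  refine ⟨N, fun m hm n hn => ?_⟩
  have h := sqDist_le_of_gaussI_le hκ hE (hμ m).1 (hμ n).1 hw (hμ m).2 (hμ n).2
  have h1 := Nat.one_div_le_one_div (α := ℝ) hm
  have h2 := Nat.one_div_le_one_div (α := ℝ) hn
  rw [strongDist, Real.sqrt_lt' hε]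
  rw [sqDist] at h
  linarith

theorem StrongTendstoSeq.tendsto_sqDist (hE : EnergyPrinciple κ) {μ : ℕ → Measure X}
    {μ₀ : Measure X} (hμ : ∀ n, memEplus κ (μ n)) (hμ₀ : memEplus κ μ₀)
    (h : StrongTendstoSeq κ μ μ₀) : Tendsto (fun n => sqDist κ (μ n) μ₀) atTop (𝓝 0) := by
  have h1 := h.pow 2
  rw [zero_pow two_ne_zero] at h1
  refine h1.congr fun n => ?_
  exact Real.sq_sqrt (hE.sqDist_nonneg (hμ n) hμ₀)

variable [T2Space X] [LocallyCompactSpace X] [BorelSpace X]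

/-- The strong limit of unit measures concentrated on a quasicompact set is again such a
measure. -/
theorem Quasicompact.memBreve_of_strongTendsto (hA : Quasicompact κ A) (hκ : IsKernel κ)
    (hperf : IsPerfect κ) {μ : ℕ → Measure X} {μ₀ : Measure X} (hμ : ∀ n, memBreve κ A (μ n))
    (hμ₀ : memEplus κ μ₀) (h : StrongTendstoSeq κ μ μ₀) : memBreve κ A μ₀ := by
  have hE := hperf.1
  have hv : VagueTendstoSeq μ μ₀ := hperf.2.2 μ μ₀ (fun n => (hμ n).1) hμ₀ h
  have := fun n => (hμ n).finiteEnergy.isFiniteMeasure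
  have := fun n => (hμ n).finiteEnergy.regular
  have : μ₀.Regular := hμ₀.1
  have hle : μ₀ univ ≤ 1 := hv.measure_univ_le fun n => (hμ n).2.2.le
  have : IsFiniteMeasure μ₀ := ⟨hle.trans_lt one_lt_top⟩
  have hF : FiniteEnergy κ μ₀ := ⟨hμ₀.1, this, hμ₀.2⟩
  obtain ⟨R, hR⟩ := (tendsto_energy hκ hE (fun n => (hμ n).finiteEnergy) hF
    (h.tendsto_sqDist hE (fun n => (hμ n).1) hμ₀)).bddAbove_range
  have hM : ∀ n, energy κ (μ n) ≤ ENNReal.ofReal R + energy κ μ₀ := fun n => by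
    refine le_add_right ?_
    rw [← ENNReal.ofReal_toReal (hμ n).1.2.ne]
    exact ENNReal.ofReal_le_ofReal (hR ⟨n, rfl⟩)
  have hc : ∀ n, μ n Aᶜ = 0 := fun n => (hμ n).2.1.measure_compl_eq_zero
  have key : ∀ δ : NNReal, 0 < δ → 1 ≤ μ₀ univ + δ ∧ μ₀ Aᶜ ≤ δ + δ := by
    intro δ hδ
    obtain ⟨K, D, hK, hD, hKD, hDδ⟩ := hA.exists_isCompact_isOpen hE
      (M := ENNReal.ofReal R + energy κ μ₀) (add_lt_top.2 ⟨ofReal_lt_top, hμ₀.2⟩).ne hδ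
    have hD0 := hDδ μ₀ hF le_add_self
    have hDn := fun n => hDδ (μ n) (hμ n).finiteEnergy (hM n)
    have hcover : ∀ x, x ∈ A → x ∉ K → x ∈ D := fun x hx hxK => hKD (Or.inl ⟨hx, hxK⟩)
    have hcover' : ∀ x, x ∉ A → x ∈ K → x ∈ D := fun x hx hxK => hKD (Or.inr ⟨hxK, hx⟩)
    have hKc : ∀ n, μ n Kᶜ ≤ δ := fun n => by
      calc μ n Kᶜ ≤ μ n (Aᶜ ∪ D) := measure_mono fun x hx => by
            by_cases hxA : x ∈ A
            · exact Or.inr (hcover x hxA hx)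
            · exact Or.inl hxA
        _ ≤ μ n Aᶜ + μ n D := measure_union_le _ _
        _ ≤ δ := by rw [hc, zero_add]; exact hDn n
    constructor
    · refine hv.le_measure_univ_add hK fun n => ?_
      rw [← (hμ n).2.2, ← measure_add_measure_compl hK.measurableSet]
      gcongr
      exact hKc n
    · have h0 : μ₀ Kᶜ ≤ δ := by
        have h1 := hv.lintegral_le (g := Kᶜ.indicator 1)
          (hK.isClosed.isOpen_compl.lowerSemicontinuous_indicator zero_le_one)
          (b := fun _ => (δ : ℝ≥0∞)) (fun n => ?_) tendsto_const_nhds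
        · rwa [lintegral_indicator_one hK.measurableSet.compl] at h1
        · rw [lintegral_indicator_one hK.measurableSet.compl]
          exact hKc n
      calc μ₀ Aᶜ ≤ μ₀ (Kᶜ ∪ D) := measure_mono fun x hx => by
            by_cases hxK : x ∈ K
            · exact Or.inr (hcover' x hx hxK)
            · exact Or.inl hxK
        _ ≤ μ₀ Kᶜ + μ₀ D := measure_union_le _ _
        _ ≤ δ + δ := add_le_add h0 hD0
  refine ⟨hμ₀, fun K _ => measure_mono_null inter_subset_left ?_, le_antisymm hle ?_⟩
  · refine le_antisymm (ENNReal.le_of_forall_pos_le_add fun ε hε _ => ?_) bot_le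
    refine (key (ε / 2) (half_pos hε)).2.trans ?_
    rw [zero_add, ← ENNReal.coe_add, add_halves]
  · exact ENNReal.le_of_forall_pos_le_add fun ε hε _ => (key ε hε).1

/-- The Gauss functional of a unit measure in terms of a decomposition of the field. -/
theorem gaussI_eq (hκ : IsKernel κ) (hE : EnergyPrinciple κ) {g : X → ℝ≥0∞} {c : ℝ}
    {ϑp ϑm : Measure X} (hg : LowerSemicontinuous g) (hp : memEplus κ ϑp) (hm : memEplus κ ϑm)
    (hf : ∀ x, f x =
      (g x : EReal) - (c : ℝ) + (potential κ ϑp x : EReal) - (potential κ ϑm x : EReal))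
    {μ : Measure X} (hμ : memBreve κ A μ) (hgi : ∫⁻ x, g x ∂μ ≠ ⊤) :
    FieldIntegrable f μ ∧ gaussI κ f μ = (energy κ μ).toReal + 2 * ((∫⁻ x, g x ∂μ).toReal - c +
      (∫⁻ x, potential κ ϑp x ∂μ).toReal - (∫⁻ x, potential κ ϑm x ∂μ).toReal) := by
  have : IsProbabilityMeasure μ := ⟨hμ.2.2⟩
  have : ϑp.Regular := hp.1
  have : ϑm.Regular := hm.1
  have m1 : AEMeasurable g μ := hg.measurable.aemeasurable
  have m2 : AEMeasurable (potential κ ϑp) μ :=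
    (lowerSemicontinuous_potential_of_regular hκ.2 ϑp).measurable.aemeasurable
  have m3 : AEMeasurable (potential κ ϑm) μ :=
    (lowerSemicontinuous_potential_of_regular hκ.2 ϑm).measurable.aemeasurable
  have i2 := lintegral_potential_ne_top hκ.2 hE hμ.finiteEnergy hp
  have i3 := lintegral_potential_ne_top hκ.2 hE hμ.finiteEnergy hm
  exact ⟨fieldIntegrable_of_lintegral_ne_top hf m1 m2 m3 hgi i2 i3, by
    rw [gaussI, fieldIntegral_eq hf m1 m2 m3 hgi i2 i3]⟩

theorem Admissible.lintegral_ne_top (hκ : IsKernel κ) (hE : EnergyPrinciple κ) {g : X → ℝ≥0∞}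
    {c : ℝ} {ϑp ϑm : Measure X} (hp : memEplus κ ϑp) (hm : memEplus κ ϑm)
    (hf : ∀ x, f x =
      (g x : EReal) - (c : ℝ) + (potential κ ϑp x : EReal) - (potential κ ϑm x : EReal))
    {μ : Measure X} (hμ : Admissible κ A f μ) : ∫⁻ x, g x ∂μ ≠ ⊤ := by
  have : IsProbabilityMeasure μ := ⟨hμ.1.2.2⟩
  have : ϑp.Regular := hp.1
  have : ϑm.Regular := hm.1
  exact hμ.2.lintegral_ne_top hf
    (lowerSemicontinuous_potential_of_regular hκ.2 ϑp).measurable.aemeasurable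
    (lowerSemicontinuous_potential_of_regular hκ.2 ϑm).measurable.aemeasurable
    (lintegral_potential_ne_top hκ.2 hE hμ.1.finiteEnergy hp)
    (lintegral_potential_ne_top hκ.2 hE hμ.1.finiteEnergy hm)

theorem wf_ne_bot (hκ : IsKernel κ) (hE : EnergyPrinciple κ) (hf : IsExternalField κ f) :
    wf κ A f ≠ ⊥ := by
  obtain ⟨g, c, ϑp, ϑm, hg, hp, hm, hfe⟩ := hf.exists_decomposition
  refine ne_bot_of_le_ne_bot (EReal.coe_ne_bot (-2 * c - (energy κ ϑm).toReal))
    (le_iInf₂ fun μ hμ => EReal.coe_le_coe_iff.2 ?_)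
  have hgi := hμ.lintegral_ne_top hκ hE hp hm hfe
  rw [(gaussI_eq hκ hE hg hp hm hfe hμ.1 hgi).2]
  have h1 := ENNReal.toReal_mono (add_lt_top.2 ⟨hμ.1.1.2, hm.2⟩).ne
    (two_mul_lintegral_potential_le hκ.2 hE hμ.1.finiteEnergy hm)
  rw [ENNReal.toReal_add hμ.1.1.2.ne hm.2.ne, ENNReal.toReal_mul] at h1
  simp only [toReal_ofNat] at h1
  have h2 : 0 ≤ (∫⁻ x, g x ∂μ).toReal := toReal_nonneg
  have h3 : 0 ≤ (∫⁻ x, potential κ ϑp x ∂μ).toReal := toReal_nonneg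
  linarith

/-- Lower semicontinuity of the Gauss functional along strongly convergent sequences. -/
theorem admissible_and_gaussI_le_of_tendsto (hκ : IsKernel κ) (hperf : IsPerfect κ)
    (hf : IsExternalField κ f) {μ : ℕ → Measure X} {μ₀ : Measure X}
    (hμ : ∀ n, Admissible κ A f (μ n)) (hμ₀ : memBreve κ A μ₀) (h : StrongTendstoSeq κ μ μ₀)
    {b : ℕ → ℝ} {w : ℝ} (hb : ∀ n, gaussI κ f (μ n) ≤ b n) (hbw : Tendsto b atTop (𝓝 w)) :
    Admissible κ A f μ₀ ∧ gaussI κ f μ₀ ≤ w := by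
  have hE := hperf.1
  obtain ⟨g, c, ϑp, ϑm, hg, hp, hm, hfe⟩ := hf.exists_decomposition
  have hv : VagueTendstoSeq μ μ₀ := hperf.2.2 μ μ₀ (fun n => (hμ n).1.1) hμ₀.1 h
  have hs := h.tendsto_sqDist hE (fun n => (hμ n).1.1) hμ₀.1
  have := fun n => (hμ n).1.finiteEnergy.isFiniteMeasure
  have := hμ₀.finiteEnergy.isFiniteMeasure
  have : μ₀.Regular := hμ₀.1.1
  have t1 := tendsto_energy hκ hE (fun n => (hμ n).1.finiteEnergy) hμ₀.finiteEnergy hs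
  have t2 := tendsto_lintegral_potential hκ hE (fun n => (hμ n).1.finiteEnergy)
    hμ₀.finiteEnergy hp hs
  have t3 := tendsto_lintegral_potential hκ hE (fun n => (hμ n).1.finiteEnergy)
    hμ₀.finiteEnergy hm hs
  have t4 := ((((hbw.sub t1).div_const 2).add_const c).sub t2).add t3
  have hle : ∀ n, (∫⁻ x, g x ∂(μ n)).toReal ≤ (b n - (energy κ (μ n)).toReal) / 2 + c -
      (∫⁻ x, potential κ ϑp x ∂(μ n)).toReal + (∫⁻ x, potential κ ϑm x ∂(μ n)).toReal := by
    intro n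
    have h1 := hb n
    rw [(gaussI_eq hκ hE hg hp hm hfe (hμ n).1
      ((hμ n).lintegral_ne_top hκ hE hp hm hfe)).2] at h1
    linarith
  have hB := ge_of_tendsto' t4 fun n => (toReal_nonneg (a := ∫⁻ x, g x ∂(μ n))).trans (hle n)
  have hG := hv.lintegral_le hg (fun n => ?_) (ENNReal.tendsto_ofReal t4)
  · have hgi : ∫⁻ x, g x ∂μ₀ ≠ ⊤ := (hG.trans_lt ofReal_lt_top).ne
    obtain ⟨h1, h2⟩ := gaussI_eq hκ hE hg hp hm hfe hμ₀ hgi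
    refine ⟨⟨hμ₀, h1⟩, ?_⟩
    have h3 := ENNReal.toReal_le_of_le_ofReal hB hG
    rw [h2]
    linarith
  · rw [← ENNReal.ofReal_toReal ((hμ n).lintegral_ne_top hκ hE hp hm hfe)]
    exact ENNReal.ofReal_le_ofReal (hle n)

theorem exists_isSolution (hκ : IsKernel κ) (hperf : IsPerfect κ) (hf : IsExternalField κ f)
    (hA : Quasicompact κ A) (hw : wf κ A f < ⊤) : ∃ μ : Measure X, IsSolution κ A f μ := by
  obtain ⟨w, hw⟩ : ∃ w : ℝ, wf κ A f = w :=
    ⟨_, (EReal.coe_toReal hw.ne (wf_ne_bot hκ hperf.1 hf)).symm⟩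
  obtain ⟨μ, hμ⟩ := exists_minimizing_seq hw
  have hmem := fun n => (hμ n).1.1.1
  obtain ⟨μ₀, hμ₀, hlim⟩ :=
    hperf.2.1 μ hmem (strongCauchySeq_of_minimizing hκ.1 hperf.1 hw hμ)
  have hb := hA.memBreve_of_strongTendsto hκ hperf (fun n => (hμ n).1.1) hμ₀ hlim
  obtain ⟨h1, h2⟩ := admissible_and_gaussI_le_of_tendsto hκ hperf hf (fun n => (hμ n).1) hb hlim
    (fun n => (hμ n).2) (by simpa using tendsto_one_div_add_atTop_nhds_zero_nat.const_add w)
  exact ⟨μ₀, h1, le_antisymm (hw ▸ EReal.coe_le_coe_iff.2 h2) (wf_le_gaussI h1)⟩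

end GaussProblem

theorem stmt1 {X : Type*} [TopologicalSpace X] [T2Space X] [LocallyCompactSpace X]
    [MeasurableSpace X] [BorelSpace X]
    (κ : X → X → ℝ≥0∞) (f : X → EReal) (A : Set X)
    (hker : IsKernel κ) (hperf : IsPerfect κ) (hf : IsExternalField κ f)
    (hqc : Quasicompact κ A) (hw : wf κ A f < ⊤) :
    ∃! l : Measure X, IsSolution κ A f l := by
  obtain ⟨l, hl⟩ := exists_isSolution hker hperf hf hqc hw
  exact ⟨l, hl, fun _ h => unique_of_isSolution hker.1 hperf.1 h hl⟩

end GaussVar
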